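/- Let k ≥ 5 and t ≥ 1 be integers. There exists n₀ such that for all n ≥ n₀, any k-uniform hypergraph on vertex set [n] with exactly C(n,k) − C(n−t,k) edges and containing no k-uniform linear cycle of length 2t+1 consists exactly of all k-subsets of [n] that meet some fixed t-element set S. -/

import Mathlib

/-- A `k`-uniform linear cycle of length `ℓ`: a cyclic list of `k`-sets such that
consecutive sets (cyclically) intersect in exactly one element and
nonconsecutive sets are disjoint. -/
def IsLinearCycle (k ℓ : ℕ) {n : ℕ} (A : ZMod ℓ → Finset (Fin n)) : Prop :=
  Function.Injective A ∧ (∀ i, (A i).card = k) ∧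
  (∀ i, (A i ∩ A (i + 1)).card = 1) ∧
  (∀ i j : ZMod ℓ, j ≠ i → j ≠ i + 1 → i ≠ j + 1 → Disjoint (A i) (A j))

namespace LinearCycle

open Finset
open scoped Classical

section Homogeneous

/-- `D` is `s`-robust in `F` if no `s` points outside `D` meet all members of `F` containing `D`. -/
def Robust {α : Type} [DecidableEq α] (s : ℕ) (F : Finset (Finset α)) (D : Finset α) : Prop :=
  ∀ Z : Finset α, #Z ≤ s → Disjoint D Z → ∃ e ∈ F, D ⊆ e ∧ Disjoint e Z

lemma Robust.mono {α : Type} [DecidableEq α] {s : ℕ} {F G : Finset (Finset α)} {D : Finset α}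
    (h : Robust s F D) (hFG : F ⊆ G) : Robust s G D := fun Z hZ hD ↦
  let ⟨e, he, hDe, hd⟩ := h Z hZ hD
  ⟨e, hFG he, hDe, hd⟩

/-- Repeatedly deleting bad fibres of the relations `r i` from `P` leaves a set `Q` all of whose
nonempty fibres are not bad. -/
lemma exists_clean_subset {α ι : Type*} (r : ι → α → Prop) (bad : ι → Finset α → Prop)
    (I : Finset ι) : ∀ P : Finset α, ∃ Q ⊆ P, ∃ R : ι → Finset α,
      (∀ i ∈ I, R i ⊆ P.filter (r i)) ∧ (∀ i ∈ I, R i = ∅ ∨ bad i (R i)) ∧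
      #P ≤ #Q + ∑ i ∈ I, #(R i) ∧ ∀ i ∈ I, ∀ p ∈ Q, r i p → ¬ bad i (Q.filter (r i)) := by
  induction I using Finset.strongInduction with
  | H I ih =>
    intro P
    by_cases h : ∃ i ∈ I, ∃ p ∈ P, r i p ∧ bad i (P.filter (r i))
    · obtain ⟨i, hi, p, hp, hrp, hbad⟩ := h
      obtain ⟨Q, hQ, R, hR, hRbad, hcard, hgood⟩ :=
        ih (I.erase i) (erase_ssubset hi) (P.filter fun p ↦ ¬ r i p)
      refine ⟨Q, hQ.trans (filter_subset _ _), Function.update R i (P.filter (r i)), ?_, ?_, ?_, ?_⟩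
      · intro j hj
        by_cases hji : j = i
        · subst hji; simp
        · rw [Function.update_of_ne hji]
          exact (hR j (mem_erase.2 ⟨hji, hj⟩)).trans (filter_subset_filter _ (filter_subset _ _))
      · intro j hj
        by_cases hji : j = i
        · subst hji; simpa using Or.inr hbad
        · rw [Function.update_of_ne hji]
          exact hRbad j (mem_erase.2 ⟨hji, hj⟩)
      · rw [← add_sum_erase _ _ hi, Function.update_self]
        have h1 : ∑ j ∈ I.erase i, #(Function.update R i (P.filter (r i)) j)
            = ∑ j ∈ I.erase i, #(R j) :=
          sum_congr rfl fun j hj ↦ by rw [Function.update_of_ne (ne_of_mem_erase hj)]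
        have h2 := card_filter_add_card_filter_not (s := P) (r i)
        omega
      · intro j hj q hq hjq
        by_cases hji : j = i
        · subst hji
          exact absurd hjq (mem_filter.1 (hQ hq)).2
        · exact hgood j (mem_erase.2 ⟨hji, hj⟩) q hq hjq
    · push Not at h
      exact ⟨P, Subset.rfl, fun _ ↦ ∅, by simp, by simp, by simp, fun i hi p hp hr ↦ h i hi p hp hr⟩

/-- Some colouring with `k` colours makes a positive proportion of a `k`-uniform family rainbow. -/
lemma exists_rainbow_coloring {α : Type} [Fintype α] [DecidableEq α] {k : ℕ} [NeZero k]
    (F : Finset (Finset α)) (hF : ∀ e ∈ F, #e = k) :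
    ∃ χ : α → Fin k, #F ≤ k ^ k * #(F.filter fun e : Finset α ↦ Set.InjOn χ e) := by
  have key : ∀ e ∈ F, Fintype.card (α → Fin k) ≤
      k ^ k * #(univ.filter fun χ : α → Fin k ↦ Set.InjOn χ e) := by
    intro e he
    have hc := hF e he
    have φ : e ≃ Fin k := e.equivFinOfCardEq hc
    have hk : k ^ k = Fintype.card (e → Fin k) := by simp [hc]
    rw [hk, ← card_univ, ← card_univ, ← card_product]
    refine card_le_card_of_injOn
      (fun χ ↦ (fun x ↦ χ x, fun x ↦ if h : x ∈ e then φ ⟨x, h⟩ else χ x)) ?_ ?_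
    · intro χ _
      simp only [coe_product, Set.mem_prod, mem_coe, mem_univ, mem_filter, true_and]
      intro x hx y hy hxy
      have hx' : x ∈ e := hx
      have hy' : y ∈ e := hy
      simp only [hx', hy', dite_true] at hxy
      exact congrArg Subtype.val (φ.injective hxy)
    · intro χ _ χ' _ h
      simp only [Prod.mk.injEq] at h
      ext x
      by_cases hx : x ∈ e
      · exact congrArg Fin.val (congrFun h.1 ⟨x, hx⟩)
      · have := congrFun h.2 x
        simp only [hx, dite_false] at this
        rw [this]
  have hswap : ∑ e ∈ F, #(univ.filter fun χ : α → Fin k ↦ Set.InjOn χ e) =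
      ∑ χ : α → Fin k, #(F.filter fun e : Finset α ↦ Set.InjOn χ e) := by
    simp only [card_filter]
    exact sum_comm (s := F) (t := (univ : Finset (α → Fin k)))
  have hsum : ∑ _χ : α → Fin k, #F ≤
      ∑ χ : α → Fin k, k ^ k * #(F.filter fun e : Finset α ↦ Set.InjOn χ e) := by
    rw [← mul_sum, ← hswap, sum_const, smul_eq_mul, card_univ, mul_comm, ← smul_eq_mul, ← sum_const,
      mul_sum]
    exact sum_le_sum key
  obtain ⟨χ, -, h⟩ := exists_le_of_sum_le (univ_nonempty) hsum
  exact ⟨χ, h⟩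

/-- The intersection patterns of distinct members of `F` lie in `J`, with respect to `χ`. -/
def Patterned {α : Type} [DecidableEq α] {k : ℕ} (χ : α → Fin k) (F : Finset (Finset α))
    (J : Finset (Finset (Fin k))) : Prop :=
  ∀ e ∈ F, ∀ e' ∈ F, e ≠ e' → (e ∩ e').image χ ∈ J

lemma filter_mem_image_inter {α : Type} [DecidableEq α] {k : ℕ} {χ : α → Fin k}
    {e e' : Finset α} (he : Set.InjOn χ e) :
    e.filter (fun x ↦ χ x ∈ (e ∩ e').image χ) = e ∩ e' := by
  ext x
  simp only [mem_filter, mem_image, mem_inter]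
  constructor
  · rintro ⟨hx, y, ⟨hy, hy'⟩, hyx⟩
    have := he hy hx hyx
    subst this
    exact ⟨hy, hy'⟩
  · rintro ⟨hx, hx'⟩
    exact ⟨hx, x, ⟨hx, hx'⟩, rfl⟩

lemma exists_homogeneous_aux (k s m : ℕ) : ∃ K : ℕ, ∀ {α : Type} [Fintype α] [DecidableEq α]
    (χ : α → Fin k) (F : Finset (Finset α)) (J : Finset (Finset (Fin k))), #J = m →
    (∀ e ∈ F, Set.InjOn χ e) → Patterned χ F J →
    ∃ F' ⊆ F, ∃ J' ⊆ J, #F ≤ K * #F' ∧ Patterned χ F' J' ∧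
      ∀ A ∈ J', ∀ e ∈ F', Robust s F' (e.filter (χ · ∈ A)) := by
  induction m with
  | zero =>
    refine ⟨1, fun χ F J hJ _ hP ↦ ⟨F, Subset.rfl, J, Subset.rfl, by simp, hP, ?_⟩⟩
    rw [card_eq_zero] at hJ
    simp [hJ]
  | succ m ih =>
    obtain ⟨K, hK⟩ := ih
    refine ⟨2 + 2 * (m + 1) * s * K, fun {α} _ _ χ F J hJ hinj hP ↦ ?_⟩
    obtain ⟨r, hr⟩ : ∃ r : Finset (Fin k) × Finset α → Finset α → Prop,
        ∀ i e, r i e ↔ e.filter (χ · ∈ i.1) = i.2 := ⟨_, fun _ _ ↦ Iff.rfl⟩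
    let bad : Finset (Fin k) × Finset α → Finset (Finset α) → Prop :=
      fun i X ↦ ∃ Z : Finset α, #Z ≤ s ∧ Disjoint i.2 Z ∧ ∀ e ∈ X, ¬ Disjoint e Z
    obtain ⟨Q, hQ, R, hR, hRbad, hcard, hgood⟩ := exists_clean_subset r bad (J ×ˢ univ) F
    by_cases hbig : #F ≤ 2 * #Q
    · refine ⟨Q, hQ, J, Subset.rfl, hbig.trans (Nat.mul_le_mul_right _ (by omega)),
        fun e he e' he' ↦ hP e (hQ he) e' (hQ he'), fun A hA e he Z hZ hD ↦ ?_⟩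
      have := hgood (A, e.filter (χ · ∈ A)) (by simp [hA]) e he ((hr _ _).2 rfl)
      simp only [bad, not_exists, not_and, not_forall, not_not] at this
      obtain ⟨e', he', hd⟩ := this Z hZ hD
      rw [mem_filter, hr] at he'
      refine ⟨e', he'.1, ?_, hd⟩
      have h2 : e'.filter (χ · ∈ A) = e.filter (χ · ∈ A) := he'.2
      rw [← h2]
      exact filter_subset _ _
    · have hsplit : ∀ i ∈ J ×ˢ (univ : Finset (Finset α)), ∃ X ⊆ R i, #(R i) ≤ s * #X ∧
          (X = ∅ ∨ ∃ z ∉ i.2, ∀ e ∈ X, z ∈ e) := by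
        intro i hi
        rcases hRbad i hi with h | ⟨Z, hZ, hD, hX⟩
        · exact ⟨∅, by simp, by simp [h], Or.inl rfl⟩
        · rcases (R i).eq_empty_or_nonempty with h | ⟨e0, he0⟩
          · exact ⟨∅, by simp, by simp [h], Or.inl rfl⟩
          have hcov : R i ⊆ Z.biUnion fun z ↦ (R i).filter (z ∈ ·) := by
            intro e he
            obtain ⟨z, hz, hz'⟩ := not_disjoint_iff.1 (hX e he)
            exact mem_biUnion.2 ⟨z, hz', by simp [he, hz]⟩
          have hsum := (card_le_card hcov).trans card_biUnion_le
          have hZne : Z.Nonempty := by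
            obtain ⟨z, -, hz'⟩ := not_disjoint_iff.1 (hX e0 he0)
            exact ⟨z, hz'⟩
          obtain ⟨z, hz, hmax⟩ := exists_max_image Z (fun z ↦ #((R i).filter (z ∈ ·))) hZne
          refine ⟨(R i).filter (z ∈ ·), filter_subset _ _, ?_, Or.inr ⟨z, ?_, ?_⟩⟩
          · exact hsum.trans ((sum_le_card_nsmul _ _ _ hmax).trans
              (by rw [smul_eq_mul]; exact Nat.mul_le_mul_right _ hZ))
          · exact fun h ↦ disjoint_left.1 hD h hz
          · intro e he
            exact (mem_filter.1 he).2
      choose! X hXR hXcard hXz using hsplit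
      rw [sum_product] at hcard
      obtain ⟨A, hA, hAmax⟩ := exists_max_image J (fun A ↦ ∑ D, #(R (A, D)))
        (card_pos.1 (by omega))
      have h1 : #F ≤ 2 * ((m + 1) * ∑ D, #(R (A, D))) := by
        have := sum_le_card_nsmul _ _ _ hAmax
        rw [smul_eq_mul, hJ] at this
        omega
      let F1 : Finset (Finset α) := univ.biUnion fun D ↦ X (A, D)
      have hmemX : ∀ D, ∀ e ∈ X (A, D), e ∈ F ∧ e.filter (χ · ∈ A) = D := by
        intro D e he
        have hi : (A, D) ∈ J ×ˢ (univ : Finset (Finset α)) := by simp [hA]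
        have := hR _ hi (hXR _ hi he)
        rwa [mem_filter, hr] at this
      have hF1 : ∑ D, #(R (A, D)) ≤ s * #F1 := by
        rw [card_biUnion, mul_sum]
        · exact sum_le_sum fun D _ ↦ hXcard _ (by simp [hA])
        · intro D _ D' _ hDD'
          refine disjoint_left.2 fun e he he' ↦ hDD' ?_
          rw [← (hmemX D e he).2, (hmemX D' e he').2]
      have hF1F : F1 ⊆ F := by
        intro e he
        obtain ⟨D, -, he⟩ := mem_biUnion.1 he
        exact (hmemX D e he).1
      obtain ⟨F', hF', J', hJ', hc, hP', hrob⟩ := hK χ F1 (J.erase A)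
        (by rw [card_erase_of_mem hA, hJ]; rfl) (fun e he ↦ hinj e (hF1F he)) (by
          intro e he e' he' hne
          refine mem_erase.2 ⟨fun hAe ↦ ?_, hP e (hF1F he) e' (hF1F he') hne⟩
          have h2 := filter_mem_image_inter (e' := e') (hinj e (hF1F he))
          have h3 := filter_mem_image_inter (e' := e) (hinj e' (hF1F he'))
          rw [inter_comm e' e, hAe] at h3
          rw [hAe] at h2
          obtain ⟨D, -, he⟩ := mem_biUnion.1 he
          obtain ⟨D', -, he'⟩ := mem_biUnion.1 he'
          have hD := (hmemX D e he).2
          have hD' := (hmemX D' e' he').2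
          have : D' = D := by rw [← hD, ← hD', h2, h3]
          subst this
          rcases hXz (A, D') (by simp [hA]) with h0 | ⟨z, hz, hze⟩
          · simp [h0] at he
          · apply hz
            change z ∈ D'
            rw [← hD, h2]
            exact mem_inter.2 ⟨hze e he, hze e' he'⟩)
      refine ⟨F', hF'.trans hF1F, J', hJ'.trans (erase_subset _ _), ?_, hP', hrob⟩
      calc #F ≤ 2 * ((m + 1) * (s * (K * #F'))) := by
            refine h1.trans ?_
            gcongr
            exact hF1.trans (by gcongr)
        _ = 2 * (m + 1) * s * K * #F' := by ring
        _ ≤ _ := by gcongr; omega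

/-- A rainbow `k`-uniform family whose pairwise intersection patterns are the members of `J`, each
of them being a robust subset of every edge. -/
structure Homogeneous {α : Type} [DecidableEq α] {k : ℕ} (s : ℕ) (χ : α → Fin k)
    (F : Finset (Finset α)) (J : Finset (Finset (Fin k))) : Prop where
  card_eq : ∀ e ∈ F, #e = k
  injOn : ∀ e ∈ F, Set.InjOn χ e
  patterned : Patterned χ F J
  robust : ∀ A ∈ J, ∀ e ∈ F, Robust s F (e.filter (χ · ∈ A))
  univ_notMem : univ ∉ J

/-- The homogeneous subfamily theorem of Füredi, with robustness in place of sunflowers. -/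
lemma exists_homogeneous (k s : ℕ) [NeZero k] : ∃ K : ℕ, ∀ {α : Type} [Fintype α] [DecidableEq α]
    (F : Finset (Finset α)), (∀ e ∈ F, #e = k) →
    ∃ χ : α → Fin k, ∃ F' ⊆ F, ∃ J, #F ≤ K * #F' ∧ Homogeneous s χ F' J := by
  obtain ⟨K, hK⟩ := exists_homogeneous_aux k s #((univ : Finset (Finset (Fin k))).erase univ)
  refine ⟨k ^ k * K, fun {α} _ _ F hF ↦ ?_⟩
  obtain ⟨χ, hχ⟩ := exists_rainbow_coloring F hF
  obtain ⟨F', hF', J, hJ, hc, hP, hrob⟩ := hK χ (F.filter fun e : Finset α ↦ Set.InjOn χ e) _ rfl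
    (fun e he ↦ (mem_filter.1 he).2) (by
      intro e he e' he' hne
      refine mem_erase.2 ⟨fun h ↦ hne ?_, mem_univ _⟩
      rw [mem_filter] at he he'
      have h2 := filter_mem_image_inter (e' := e') he.2
      have h3 := filter_mem_image_inter (e' := e) he'.2
      rw [inter_comm e' e, h] at h3
      rw [h] at h2
      simp only [mem_univ, filter_true] at h2 h3
      rw [h2, ← h3])
  have hsub := hF'.trans (filter_subset _ _)
  refine ⟨χ, F', hsub, J, ?_, fun e he ↦ hF e (hsub he),
    fun e he ↦ (mem_filter.1 (hF' he)).2, hP, hrob, fun h ↦ by simpa using hJ h⟩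
  calc #F ≤ k ^ k * (K * #F') := hχ.trans (by gcongr)
    _ = _ := by ring

end Homogeneous

section Patterns

lemma compl_mem_of_forall_mem {k : ℕ} {J : Finset (Finset (Fin k))}
    (hJ : ∀ A ∈ J, ∀ B ∈ J, A ∩ B ∈ J) {T : Finset (Fin k)} (hT : T.Nonempty)
    (h : ∀ b ∈ T, ∃ U ⊆ T, b ∈ U ∧ Uᶜ ∈ J) : Tᶜ ∈ J := by
  choose! g hg using h
  have key : ∀ S : Finset (Fin k), S.Nonempty → S ⊆ T → (S.biUnion g)ᶜ ∈ J := by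
    intro S hS
    induction hS using Finset.Nonempty.cons_induction with
    | singleton a =>
      intro haT
      simpa using (hg a (haT (mem_singleton_self a))).2.2
    | cons a S ha hS ih =>
      intro haT
      rw [cons_eq_insert, biUnion_insert, compl_union]
      rw [cons_eq_insert, insert_subset_iff] at haT
      exact hJ _ (hg a haT.1).2.2 _ (ih haT.2)
  have hcov : T.biUnion g = T := by
    ext b
    simp only [mem_biUnion]
    exact ⟨fun ⟨a, ha, hb⟩ ↦ (hg a ha).1 hb, fun hb ↦ ⟨b, hb, (hg b hb).2.1⟩⟩
  simpa [hcov] using key T hT Subset.rfl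

/-- An intersection-closed family of proper subsets of `Fin k` covering all `(k - 2)`-sets contains
either all proper sets through some point, or three pairs forming a triangle. -/
lemma star_or_triangle {k : ℕ} (hk : 5 ≤ k) {J : Finset (Finset (Fin k))}
    (hJ : ∀ A ∈ J, ∀ B ∈ J, A ∩ B ∈ J)
    (hcov : ∀ a b, a ≠ b → ({a}ᶜ : Finset (Fin k)) ∈ J ∨ ({b}ᶜ : Finset (Fin k)) ∈ J ∨
      ({a, b}ᶜ : Finset (Fin k)) ∈ J) :
    (∃ w, ∀ A, w ∈ A → A ≠ univ → A ∈ J) ∨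
      ∃ T : Finset (Fin k), #T = 3 ∧ ∀ a ∈ T, ∀ b ∈ T, a ≠ b → {a, b} ∈ J := by
  set W : Finset (Fin k) := univ.filter fun a ↦ ({a}ᶜ : Finset (Fin k)) ∉ J with hW
  by_cases hW1 : #W ≤ 1
  · left
    obtain ⟨w, hw⟩ : ∃ w, W ⊆ {w} := by
      rcases W.eq_empty_or_nonempty with h | ⟨w, hw⟩
      · exact ⟨⟨0, by omega⟩, by simp [h]⟩
      · exact ⟨w, fun a ha ↦ mem_singleton.2 (card_le_one.1 hW1 a ha w hw)⟩
    refine ⟨w, fun A hwA hA ↦ ?_⟩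
    rw [← compl_compl A]
    refine compl_mem_of_forall_mem hJ ?_ fun b hb ↦ ⟨{b}, by simpa using hb, by simp, ?_⟩
    · rw [nonempty_iff_ne_empty, Ne, compl_eq_empty_iff]
      exact hA
    · by_contra hbJ
      have : b = w := mem_singleton.1 (hw (by simp [hW, hbJ]))
      subst this
      exact mem_compl.1 hb hwA
  · right
    obtain ⟨T, hT, hTW⟩ : ∃ T : Finset (Fin k), #T = 3 ∧
        ∀ a ∈ T, ∀ b ∈ T, 1 < #(W \ {a, b}) := by
      by_cases h3 : 3 ≤ #Wᶜ
      · obtain ⟨T, hT, hT3⟩ := exists_subset_card_eq h3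
        refine ⟨T, hT3, fun a ha b hb ↦ ?_⟩
        rw [sdiff_eq_self_of_disjoint]
        · omega
        · rw [disjoint_right]
          intro x hx
          rw [mem_insert, mem_singleton] at hx
          rcases hx with rfl | rfl
          · exact mem_compl.1 (hT ha)
          · exact mem_compl.1 (hT hb)
      · obtain ⟨T, hT, -, hT3⟩ := exists_subsuperset_card_eq (subset_univ Wᶜ)
          (show #Wᶜ ≤ 3 by omega) (by simp; omega)
        refine ⟨T, hT3, fun a ha b hb ↦ ?_⟩
        have h1 : Tᶜ ⊆ W \ {a, b} := by
          intro x hx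
          rw [mem_compl] at hx
          rw [mem_sdiff]
          refine ⟨by_contra fun h ↦ hx (hT (mem_compl.2 h)), fun h ↦ hx ?_⟩
          rw [mem_insert, mem_singleton] at h
          rcases h with rfl | rfl <;> assumption
        have h2 := card_le_card h1
        rw [card_compl, Fintype.card_fin] at h2
        omega
    refine ⟨T, hT, fun a ha b hb hab ↦ ?_⟩
    obtain ⟨u, hu, v, hv, huv⟩ := one_lt_card.1 (hTW a ha b hb)
    rw [mem_sdiff] at hu hv
    rw [← compl_compl ({a, b} : Finset (Fin k))]
    have hpair : ∀ x ∈ W, ∀ y ∈ W, x ≠ y → ({x, y}ᶜ : Finset (Fin k)) ∈ J := by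
      intro x hx y hy hxy
      rcases hcov x y hxy with h | h | h
      · exact absurd h (mem_filter.1 hx).2
      · exact absurd h (mem_filter.1 hy).2
      · exact h
    refine compl_mem_of_forall_mem hJ ⟨u, mem_compl.2 hu.2⟩ fun c hc ↦ ?_
    by_cases hcW : c ∈ W
    · by_cases hcu : c = u
      · subst hcu
        refine ⟨{c, v}, ?_, by simp, hpair c hu.1 v hv.1 huv⟩
        rw [insert_subset_iff, singleton_subset_iff, mem_compl, mem_compl]
        exact ⟨hu.2, hv.2⟩
      · refine ⟨{c, u}, ?_, by simp, hpair c hcW u hu.1 hcu⟩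
        rw [insert_subset_iff, singleton_subset_iff]
        exact ⟨hc, mem_compl.2 hu.2⟩
    · refine ⟨{c}, by simpa using hc, by simp, ?_⟩
      simpa [hW] using hcW

variable {α : Type} [DecidableEq α] {k s : ℕ} {χ : α → Fin k} {F : Finset (Finset α)}
  {J : Finset (Finset (Fin k))}

lemma Homogeneous.exists_mem_color (h : Homogeneous s χ F J) {e : Finset α} (he : e ∈ F)
    (c : Fin k) : ∃ x ∈ e, χ x = c := by
  have : e.image χ = univ := by
    rw [← card_eq_iff_eq_univ, card_image_of_injOn (h.injOn e he), h.card_eq e he,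
      Fintype.card_fin]
  simpa using (this ▸ mem_univ c : c ∈ e.image χ)

lemma Homogeneous.image_filter (h : Homogeneous s χ F J) {e : Finset α} (he : e ∈ F)
    (A : Finset (Fin k)) : (e.filter (χ · ∈ A)).image χ = A := by
  ext c
  simp only [mem_image, mem_filter]
  constructor
  · rintro ⟨x, ⟨-, hx⟩, rfl⟩
    exact hx
  · intro hc
    obtain ⟨x, hx, rfl⟩ := h.exists_mem_color he c
    exact ⟨x, ⟨hx, hc⟩, rfl⟩

lemma Homogeneous.card_filter (h : Homogeneous s χ F J) {e : Finset α} (he : e ∈ F)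
    (A : Finset (Fin k)) : #(e.filter (χ · ∈ A)) = #A := by
  rw [← card_image_of_injOn ((h.injOn e he).mono (coe_subset.2 (filter_subset _ _))), h.image_filter he]

lemma Homogeneous.inter_mem (h : Homogeneous s χ F J) (hs : 2 * k ≤ s) (hF : F.Nonempty)
    {A B : Finset (Fin k)} (hA : A ∈ J) (hB : B ∈ J) : A ∩ B ∈ J := by
  obtain ⟨e, he⟩ := hF
  have hek := h.card_eq e he
  obtain ⟨e', he', hAe', hd'⟩ := h.robust A hA e he (e \ e.filter (χ · ∈ A))
    ((card_le_card sdiff_subset).trans (by omega)) disjoint_sdiff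
  obtain ⟨e'', he'', hBe'', hd''⟩ := h.robust B hB e he ((e ∪ e') \ e.filter (χ · ∈ B))
    ((card_le_card sdiff_subset).trans ((card_union_le _ _).trans
      (by rw [hek, h.card_eq e' he']; omega))) disjoint_sdiff
  have hinter : e' ∩ e'' = e.filter (χ · ∈ A ∩ B) := by
    ext x
    rw [mem_inter, mem_filter, mem_inter]
    constructor
    · rintro ⟨hx', hx''⟩
      have h1 : x ∈ e.filter (χ · ∈ B) := by
        by_contra hx
        exact disjoint_left.1 hd'' hx'' (mem_sdiff.2 ⟨mem_union_right _ hx', hx⟩)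
      have h2 : x ∈ e.filter (χ · ∈ A) := by
        by_contra hx
        exact disjoint_left.1 hd' hx' (mem_sdiff.2 ⟨(mem_filter.1 h1).1, hx⟩)
      exact ⟨(mem_filter.1 h1).1, (mem_filter.1 h2).2, (mem_filter.1 h1).2⟩
    · rintro ⟨hx, hxA, hxB⟩
      exact ⟨hAe' (mem_filter.2 ⟨hx, hxA⟩), hBe'' (mem_filter.2 ⟨hx, hxB⟩)⟩
  have hne : e' ≠ e'' := by
    rintro rfl
    rw [inter_self] at hinter
    have h1 := h.card_eq e' he'
    rw [hinter, h.card_filter he] at h1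
    have h2 := card_le_card (inter_subset_left : A ∩ B ⊆ A)
    have h3 : A = univ := by
      rw [← card_eq_iff_eq_univ, Fintype.card_fin]
      have := card_le_univ A
      rw [Fintype.card_fin] at this
      omega
    exact h.univ_notMem (h3 ▸ hA)
  have := h.patterned e' he' e'' he'' hne
  rwa [hinter, h.image_filter he] at this

/-- A pattern not contained in any member of `J` is an own subset of every edge. -/
lemma Homogeneous.card_le_of_forall_not_subset (h : Homogeneous s χ F J) {T : Finset (Fin k)}
    (hT : ∀ A ∈ J, ¬ T ⊆ A) {S : Finset (Finset α)}
    (hS : ∀ e ∈ F, ∀ f ⊆ e, #f = #T → f ∈ S) : #F ≤ #S := by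
  refine card_le_card_of_injOn (fun e ↦ e.filter (χ · ∈ T))
    (fun e he ↦ hS e he _ (filter_subset _ _) (h.card_filter he T)) ?_
  intro e he e' he' hee'
  by_contra hne
  refine hT _ (h.patterned e he e' he' hne) fun c hc ↦ ?_
  obtain ⟨x, hx, rfl⟩ := h.exists_mem_color he c
  have hx' : x ∈ e.filter (χ · ∈ T) := mem_filter.2 ⟨hx, hc⟩
  have hx'' : x ∈ e'.filter (χ · ∈ T) := (congrArg (x ∈ ·) hee').mp hx'
  exact mem_image.2 ⟨x, mem_inter.2 ⟨hx, (mem_filter.1 hx'').1⟩, rfl⟩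

end Patterns

section Embedding

lemma exists_greedy_seq {α : Type} {N : ℕ} {Inv : ℕ → α → Prop} {R : ℕ → α → α → Prop} {y₀ : α}
    (h₀ : Inv 0 y₀)
    (step : ∀ i v, Inv i v → ∀ Z : Finset α, #Z ≤ N → v ∉ Z →
      ∃ v' ∉ Z, v' ≠ v ∧ Inv (i + 1) v' ∧ R i v v') :
    ∀ m ≤ N, ∃ y : ℕ → α, Set.InjOn y (Set.Iic m) ∧ y 0 = y₀ ∧ (∀ i ≤ m, Inv i (y i)) ∧
      ∀ i < m, R i (y i) (y (i + 1)) := by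
  intro m
  induction m with
  | zero =>
    intro _
    refine ⟨fun _ ↦ y₀, ?_, rfl, ?_, by simp⟩
    · intro a ha b hb _
      simp only [Set.mem_Iic, Nat.le_zero] at ha hb
      rw [ha, hb]
    · intro i hi
      rw [Nat.le_zero.1 hi]
      exact h₀
  | succ m ih =>
    intro hm
    obtain ⟨y, hinj, hy0, hInv, hR⟩ := ih (by omega)
    have hnot : y m ∉ (range m).image y := by
      intro hmem
      obtain ⟨i, hi, hiy⟩ := mem_image.1 hmem
      rw [mem_range] at hi
      have := hinj (by simpa using hi.le) (by simp) hiy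
      omega
    obtain ⟨v, hvZ, hvne, hv, hRv⟩ := step m (y m) (hInv m le_rfl) ((range m).image y)
      (card_image_le.trans (by simp; omega)) hnot
    have hne : ∀ i ≤ m, y i ≠ v := by
      intro i hi hiv
      rcases hi.lt_or_eq with h | rfl
      · exact hvZ (mem_image.2 ⟨i, mem_range.2 h, hiv⟩)
      · exact hvne hiv.symm
    have hup : ∀ i ≤ m, Function.update y (m + 1) v i = y i := fun i hi ↦
      Function.update_of_ne (by omega) _ _
    refine ⟨Function.update y (m + 1) v, ?_, ?_, ?_, ?_⟩
    · intro a ha b hb hab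
      simp only [Set.mem_Iic] at ha hb
      rcases Nat.lt_or_ge m a with ha' | ha' <;> rcases Nat.lt_or_ge m b with hb' | hb'
      · omega
      · have : a = m + 1 := by omega
        subst this
        rw [Function.update_self, hup b hb'] at hab
        exact absurd hab.symm (hne b hb')
      · have : b = m + 1 := by omega
        subst this
        rw [Function.update_self, hup a ha'] at hab
        exact absurd hab (hne a ha')
      · rw [hup a ha', hup b hb'] at hab
        exact hinj ha' hb' hab
    · rw [hup 0 (by omega), hy0]
    · intro i hi
      rcases hi.lt_or_eq with h | rfl
      · rw [hup i (by omega)]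
        exact hInv i (by omega)
      · rw [Function.update_self]
        exact hv
    · intro i hi
      rcases (Nat.lt_succ_iff.1 hi).lt_or_eq with h | rfl
      · rw [hup i (by omega), hup (i + 1) (by omega)]
        exact hR i h
      · rw [hup i le_rfl, Function.update_self]
        exact hRv

variable {n k ℓ s : ℕ} {H : Finset (Finset (Fin n))}

lemma exists_linearCycle_of_zmod [NeZero ℓ] (hℓ : 3 ≤ ℓ) (hk : 3 ≤ k) (hH : ∀ e ∈ H, #e = k)
    (hs : ℓ * (k + 1) ≤ s) {x : ZMod ℓ → Fin n} (hx : Function.Injective x)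
    (hrob : ∀ i, i ≠ -1 → Robust s H {x i, x (i + 1)}) {e₀ : Finset (Fin n)} (he₀ : e₀ ∈ H)
    (h₀ : x 0 ∈ e₀) (h₁ : x (-1) ∈ e₀) (h₂ : ∀ i, i ≠ 0 → i ≠ -1 → x i ∉ e₀) :
    ∃ A : ZMod ℓ → Finset (Fin n), IsLinearCycle k ℓ A ∧ ∀ i, A i ∈ H := by
  set X : Finset (Fin n) := univ.image x with hX
  have hXcard : #X ≤ ℓ := card_image_le.trans (by simp [ZMod.card])
  have key : ∀ S : Finset (ZMod ℓ), -1 ∉ S → ∃ A : ZMod ℓ → Finset (Fin n), A (-1) = e₀ ∧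
      (∀ i ∈ insert (-1) S, A i ∈ H ∧ A i ∩ X = {x i, x (i + 1)}) ∧
      ∀ i ∈ insert (-1) S, ∀ j ∈ insert (-1) S, i ≠ j → A i ∩ A j ⊆ X := by
    intro S
    induction S using Finset.induction_on with
    | empty =>
      intro _
      refine ⟨fun _ ↦ e₀, rfl, ?_, ?_⟩
      · intro i hi
        simp only [insert_empty_eq, mem_singleton] at hi
        subst hi
        refine ⟨he₀, ?_⟩
        ext v
        simp only [mem_inter, hX, mem_image, mem_univ, true_and, neg_add_cancel, mem_insert,
          mem_singleton]
        constructor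
        · rintro ⟨hv, i, rfl⟩
          by_contra hcon
          push Not at hcon
          exact h₂ i (fun h ↦ hcon.2 (by rw [h])) (fun h ↦ hcon.1 (by rw [h])) hv
        · rintro (rfl | rfl)
          · exact ⟨h₁, _, rfl⟩
          · exact ⟨h₀, _, rfl⟩
      · intro i hi j hj hij
        simp only [insert_empty_eq, mem_singleton] at hi hj
        exact absurd (hi.trans hj.symm) hij
    | insert a S ha ih =>
      intro hS
      rw [mem_insert, not_or] at hS
      obtain ⟨A, hA0, hA, hAA⟩ := ih hS.2
      set S' := insert (-1) S with hS'
      have haS' : a ∉ S' := by simp [hS', ha, Ne.symm hS.1]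
      have hcardS : #S' ≤ ℓ := by
        have := card_le_univ S'
        rwa [ZMod.card] at this
      obtain ⟨e, he, hsub, hd⟩ := hrob a (Ne.symm hS.1) ((X ∪ S'.biUnion A) \ {x a, x (a + 1)})
        (by
          refine (card_le_card sdiff_subset).trans ((card_union_le _ _).trans ?_)
          have : #(S'.biUnion A) ≤ #S' * k :=
            card_biUnion_le_card_mul _ _ _ fun i hi ↦ (hH _ (hA i hi).1).le
          nlinarith) disjoint_sdiff
      have hsub' : x a ∈ e ∧ x (a + 1) ∈ e := by
        rwa [insert_subset_iff, singleton_subset_iff] at hsub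
      have heX : e ∩ X = {x a, x (a + 1)} := by
        apply Subset.antisymm
        · intro v hv
          rw [mem_inter] at hv
          by_contra hcon
          exact disjoint_left.1 hd hv.1 (mem_sdiff.2 ⟨mem_union_left _ hv.2, hcon⟩)
        · intro v hv
          refine mem_inter.2 ⟨hsub hv, ?_⟩
          rw [mem_insert, mem_singleton] at hv
          rcases hv with rfl | rfl <;> simp [hX]
      have heA : ∀ i ∈ S', e ∩ A i ⊆ X := by
        intro i hi v hv
        rw [mem_inter] at hv
        by_contra hcon
        refine disjoint_left.1 hd hv.1 (mem_sdiff.2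
          ⟨mem_union_right _ (mem_biUnion.2 ⟨i, hi, hv.2⟩), fun h ↦ hcon ?_⟩)
        rw [mem_insert, mem_singleton] at h
        rcases h with rfl | rfl <;> simp [hX]
      have hne : ∀ i ∈ S', i ≠ a := fun i hi h ↦ haS' (h ▸ hi)
      refine ⟨Function.update A a e, ?_, ?_, ?_⟩
      · rw [Function.update_of_ne hS.1, hA0]
      · intro i hi
        rw [insert_comm, mem_insert] at hi
        rcases hi with rfl | hi
        · rw [Function.update_self]
          exact ⟨he, heX⟩
        · rw [Function.update_of_ne (hne i hi)]
          exact hA i hi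
      · intro i hi j hj hij
        rw [insert_comm, mem_insert] at hi hj
        rcases hi with rfl | hi <;> rcases hj with rfl | hj
        · exact absurd rfl hij
        · rw [Function.update_self, Function.update_of_ne (hne j hj)]
          exact heA j hj
        · rw [Function.update_self, Function.update_of_ne (hne i hi), inter_comm]
          exact heA i hi
        · rw [Function.update_of_ne (hne i hi), Function.update_of_ne (hne j hj)]
          exact hAA i hi j hj hij
  obtain ⟨A, -, hA, hAA⟩ := key (univ.erase (-1)) (by simp)
  rw [insert_erase (mem_univ _)] at hA hAA
  have hAH : ∀ i, A i ∈ H := fun i ↦ (hA i (mem_univ i)).1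
  have hAX : ∀ i, A i ∩ X = {x i, x (i + 1)} := fun i ↦ (hA i (mem_univ i)).2
  have hmem : ∀ i j, i ≠ j → ∀ v, v ∈ A i → v ∈ A j →
      (v = x i ∨ v = x (i + 1)) ∧ (v = x j ∨ v = x (j + 1)) := by
    intro i j hij v hi hj
    have hvX := hAA i (mem_univ i) j (mem_univ j) hij (mem_inter.2 ⟨hi, hj⟩)
    have h1 : v ∈ A i ∩ X := mem_inter.2 ⟨hi, hvX⟩
    have h2 : v ∈ A j ∩ X := mem_inter.2 ⟨hj, hvX⟩
    rw [hAX, mem_insert, mem_singleton] at h1 h2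
    exact ⟨h1, h2⟩
  have hone : (1 : ZMod ℓ) ≠ 0 := by
    have : Fact (1 < ℓ) := ⟨by omega⟩
    exact one_ne_zero
  have htwo : (2 : ZMod ℓ) ≠ 0 := by
    intro h
    have h' : ((2 : ℕ) : ZMod ℓ) = 0 := by exact_mod_cast h
    rw [ZMod.natCast_eq_zero_iff] at h'
    have := Nat.le_of_dvd (by omega) h'
    omega
  refine ⟨A, ⟨?_, fun i ↦ hH _ (hAH i), ?_, ?_⟩, hAH⟩
  · intro i j hij
    by_contra hne
    have hsub : A i ⊆ {x i, x (i + 1)} := by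
      intro v hv
      have := (hmem i j hne v hv (hij ▸ hv)).1
      simpa using this
    have := (card_le_card hsub).trans card_le_two
    rw [hH _ (hAH i)] at this
    omega
  · intro i
    rw [card_eq_one]
    refine ⟨x (i + 1), ?_⟩
    ext v
    rw [mem_inter, mem_singleton]
    constructor
    · rintro ⟨hv, hv'⟩
      obtain ⟨h1, h2⟩ := hmem i (i + 1) (by simpa using hone) v hv hv'
      rcases h1 with h1 | h1
      · rcases h2 with h2 | h2
        · exact h2
        · exfalso
          have h3 := hx (h1.symm.trans h2)
          rw [add_assoc, one_add_one_eq_two] at h3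
          exact htwo (by simpa using h3)
      · exact h1
    · rintro rfl
      have h1 : x (i + 1) ∈ A i ∩ X := by rw [hAX]; simp
      have h2 : x (i + 1) ∈ A (i + 1) ∩ X := by rw [hAX]; simp
      exact ⟨(mem_inter.1 h1).1, (mem_inter.1 h2).1⟩
  · intro i j hji hji' hij
    rw [disjoint_left]
    intro v hi hj
    obtain ⟨h1, h2⟩ := hmem i j (Ne.symm hji) v hi hj
    rcases h1 with h1 | h1 <;> rcases h2 with h2 | h2
    · exact hji (hx (h2.symm.trans h1))
    · exact hij (hx (h1.symm.trans h2))
    · exact hji' (hx (h2.symm.trans h1))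
    · exact hji (add_right_cancel (hx (h2.symm.trans h1)))

/-- A path `p, y 0, …, y m` of robust pairs, closed by an edge `e₀`, yields a linear cycle. -/
lemma exists_linearCycle_of_path {m : ℕ} (hm : 1 ≤ m) (hk : 3 ≤ k) (hH : ∀ e ∈ H, #e = k)
    (hs : (m + 2) * (k + 1) ≤ s) {p : Fin n} {y : ℕ → Fin n} (hy : Set.InjOn y (Set.Iic m))
    (hp : ∀ i ≤ m, y i ≠ p) (hp0 : Robust s H {p, y 0})
    (hrob : ∀ i < m, Robust s H {y i, y (i + 1)}) {e₀ : Finset (Fin n)} (he₀ : e₀ ∈ H)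
    (h₀ : p ∈ e₀) (h₁ : y m ∈ e₀) (h₂ : ∀ i < m, y i ∉ e₀) :
    ∃ A : ZMod (m + 2) → Finset (Fin n), IsLinearCycle k (m + 2) A ∧ ∀ i, A i ∈ H := by
  set z : ℕ → Fin n := fun i ↦ Nat.casesOn i p y with hz
  have hzs : ∀ i, z (i + 1) = y i := fun i ↦ rfl
  have hz0 : z 0 = p := rfl
  have hlast : ((-1 : ZMod (m + 2))).val = m + 1 := ZMod.val_neg_one (m + 1)
  have hval : ∀ i : ZMod (m + 2), i ≠ -1 → (i + 1).val = i.val + 1 ∧ i.val ≤ m := by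
    intro i hi
    have h1 := i.val_lt
    have h2 : i.val ≠ m + 1 := fun h ↦ hi (ZMod.val_injective _ (h.trans hlast.symm))
    refine ⟨by
      rw [ZMod.val_add_of_lt] <;> rw [ZMod.val_one'' (by omega)]
      omega, by omega⟩
  refine exists_linearCycle_of_zmod (x := fun i ↦ z i.val) (by omega) hk hH hs ?_ ?_ he₀ ?_ ?_ ?_
  · intro i j hij
    apply ZMod.val_injective
    have hi := i.val_lt
    have hj := j.val_lt
    change z i.val = z j.val at hij
    rcases hi' : i.val with _ | a <;> rcases hj' : j.val with _ | b <;> rw [hi', hj'] at hij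
    · exact absurd hij.symm (hp b (by omega))
    · exact absurd hij (hp a (by omega))
    · have := hy (show a ≤ m by omega) (show b ≤ m by omega) hij
      rw [this]
  · intro i hi
    obtain ⟨h1, h2⟩ := hval i hi
    rw [h1]
    rcases hi' : i.val with _ | a
    · exact hp0
    · exact hrob a (by omega)
  · rw [ZMod.val_zero]
    exact h₀
  · rw [hlast]
    exact h₁
  · intro i hi hi1
    obtain ⟨-, h2⟩ := hval i hi1
    rcases hi' : i.val with _ | a
    · exact absurd ((ZMod.val_eq_zero i).1 hi') hi
    · exact h₂ a (by omega)

/-- The same, with the closing edge taken from a robust set containing both ends of the path. -/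
lemma exists_linearCycle_of_robust {m : ℕ} (hm : 1 ≤ m) (hk : 3 ≤ k) (hH : ∀ e ∈ H, #e = k)
    (hs : (m + 2) * (k + 1) ≤ s) {p : Fin n} {y : ℕ → Fin n} (hy : Set.InjOn y (Set.Iic m))
    (hp : ∀ i ≤ m, y i ≠ p) (hp0 : Robust s H {p, y 0})
    (hrob : ∀ i < m, Robust s H {y i, y (i + 1)}) {D : Finset (Fin n)} (hD : Robust s H D)
    (h₀ : p ∈ D) (h₁ : y m ∈ D) (h₂ : ∀ i < m, y i ∉ D) :
    ∃ A : ZMod (m + 2) → Finset (Fin n), IsLinearCycle k (m + 2) A ∧ ∀ i, A i ∈ H := by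
  obtain ⟨e, he, hDe, hd⟩ := hD ((range m).image y)
    (card_image_le.trans (by rw [card_range]; nlinarith)) (by
      rw [disjoint_right]
      intro v hv
      obtain ⟨i, hi, rfl⟩ := mem_image.1 hv
      exact h₂ i (mem_range.1 hi))
  exact exists_linearCycle_of_path hm hk hH hs hy hp hp0 hrob he (hDe h₀) (hDe h₁)
    fun i hi hie ↦ disjoint_left.1 hd hie (mem_image_of_mem _ (mem_range.2 hi))

lemma Homogeneous.exists_linearCycle {m : ℕ} (hm : 1 ≤ m) (hk : 3 ≤ k) (hH : ∀ e ∈ H, #e = k)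
    (hs : (m + 2) * (k + 1) ≤ s) {χ : Fin n → Fin k} {F : Finset (Finset (Fin n))}
    {J : Finset (Finset (Fin k))} (h : Homogeneous s χ F J) (hF : F.Nonempty) (hFH : F ⊆ H)
    {T : Finset (Fin k)} (hT : #T = 3) (hTJ : ∀ a ∈ T, ∀ b ∈ T, a ≠ b → {a, b} ∈ J) :
    ∃ A : ZMod (m + 2) → Finset (Fin n), IsLinearCycle k (m + 2) A ∧ ∀ i, A i ∈ H := by
  let Linked : Fin n → Fin n → Prop := fun u v ↦
    ∃ e ∈ F, u ∈ e ∧ v ∈ e ∧ χ u ≠ χ v ∧ χ u ∈ T ∧ χ v ∈ T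
  have hrob : ∀ u v, Linked u v → Robust s F {u, v} := by
    rintro u v ⟨e, he, hu, hv, huv, huT, hvT⟩
    have h1 : e.filter (χ · ∈ ({χ u, χ v} : Finset (Fin k))) = {u, v} := by
      ext x
      simp only [mem_filter, mem_insert, mem_singleton]
      constructor
      · rintro ⟨hx, hxu | hxv⟩
        · exact Or.inl (h.injOn e he hx hu hxu)
        · exact Or.inr (h.injOn e he hx hv hxv)
      · rintro (rfl | rfl) <;> simp [hu, hv]
    rw [← h1]
    exact h.robust _ (hTJ _ huT _ hvT huv) e he
  have hne : ∀ u v, Linked u v → u ≠ v := by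
    rintro u v ⟨e, he, hu, hv, huv, -⟩ rfl
    exact huv rfl
  have hstep : ∀ u v, Linked u v → ∀ Z : Finset (Fin n), #Z ≤ s → Disjoint {u, v} Z →
      ∃ y ∉ Z, Linked u y ∧ Linked v y := by
    intro u v huv Z hZ hd
    obtain ⟨e, he, hsub, hdisj⟩ := hrob u v huv Z hZ hd
    rw [insert_subset_iff, singleton_subset_iff] at hsub
    obtain ⟨-, -, -, -, hne, huT, hvT⟩ := huv
    obtain ⟨c, hc, hcn⟩ := exists_mem_notMem_of_card_lt_card
      (show #({χ u, χ v} : Finset (Fin k)) < #T by have := card_le_two (a := χ u) (b := χ v); omega)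
    rw [mem_insert, mem_singleton, not_or] at hcn
    obtain ⟨y, hy, rfl⟩ := h.exists_mem_color he c
    exact ⟨y, disjoint_left.1 hdisj hy, ⟨e, he, hsub.1, hy, Ne.symm hcn.1, huT, hc⟩,
      ⟨e, he, hsub.2, hy, Ne.symm hcn.2, hvT, hc⟩⟩
  obtain ⟨e, he⟩ := hF
  obtain ⟨a, b, c, hab, -, -, hTe⟩ := card_eq_three.1 hT
  obtain ⟨p, hpe, hpa⟩ := h.exists_mem_color he a
  obtain ⟨q, hqe, hqb⟩ := h.exists_mem_color he b
  have hpq : Linked p q := ⟨e, he, hpe, hqe, by rw [hpa, hqb]; exact hab,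
    by rw [hpa, hTe]; simp, by rw [hqb, hTe]; simp⟩
  obtain ⟨y, hy, -, hInv, hR⟩ := exists_greedy_seq (N := m) (Inv := fun _ v ↦ Linked p v)
    (R := fun _ u v ↦ Linked u v) hpq (by
      intro i v hv Z hZ hvZ
      obtain ⟨y, hyZ, hpy, hvy⟩ := hstep p v hv (Z.erase p)
        ((card_erase_le).trans (hZ.trans (by nlinarith))) (by
          rw [disjoint_left]
          intro x hx hxZ
          rw [mem_insert, mem_singleton] at hx
          rw [mem_erase] at hxZ
          rcases hx with rfl | rfl
          · exact hxZ.1 rfl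
          · exact hvZ hxZ.2)
      exact ⟨y, fun hy ↦ hyZ (mem_erase.2 ⟨Ne.symm (hne _ _ hpy), hy⟩), Ne.symm (hne _ _ hvy),
        hpy, hvy⟩) m le_rfl
  refine exists_linearCycle_of_robust hm hk hH hs hy (fun i hi ↦ Ne.symm (hne _ _ (hInv i hi)))
    ((hrob _ _ (hInv 0 (by omega))).mono hFH) (fun i hi ↦ (hrob _ _ (hR i hi)).mono hFH)
    ((hrob _ _ (hInv m le_rfl)).mono hFH) (by simp) (by simp) ?_
  intro i hi hmem
  rw [mem_insert, mem_singleton] at hmem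
  rcases hmem with h1 | h1
  · exact hne _ _ (hInv i hi.le) h1.symm
  · have := hy (show i ≤ m by omega) (show m ≤ m from le_rfl) h1
    omega

end Embedding

section CycleFree

/-- `H` contains no `k`-uniform linear cycle of length `ℓ`. -/
def CycleFree (k ℓ : ℕ) {n : ℕ} (H : Finset (Finset (Fin n))) : Prop :=
  ¬ ∃ A : ZMod ℓ → Finset (Fin n), IsLinearCycle k ℓ A ∧ ∀ i, A i ∈ H

lemma CycleFree.mono {k ℓ n : ℕ} {F H : Finset (Finset (Fin n))} (h : CycleFree k ℓ H)
    (hFH : F ⊆ H) : CycleFree k ℓ F := fun ⟨A, hA, hAF⟩ ↦ h ⟨A, hA, fun i ↦ hFH (hAF i)⟩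

/-- Every proper subset of the edge `e` through its vertex `w` is robust. -/
def IsCenter {α : Type} [DecidableEq α] (s : ℕ) (H : Finset (Finset α)) (e : Finset α) (w : α) :
    Prop :=
  w ∈ e ∧ ∀ A ⊆ e, w ∈ A → A ≠ e → Robust s H A

lemma Homogeneous.isCenter {α : Type} [DecidableEq α] {k s : ℕ} {χ : α → Fin k}
    {F : Finset (Finset α)} {J : Finset (Finset (Fin k))} (h : Homogeneous s χ F J)
    {c : Fin k} (hc : ∀ A, c ∈ A → A ≠ univ → A ∈ J) {e : Finset α} (he : e ∈ F) :
    ∃ w, IsCenter s F e w := by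
  obtain ⟨w, hw, rfl⟩ := h.exists_mem_color he c
  refine ⟨w, hw, fun A hA hwA hAe ↦ ?_⟩
  have hfil : e.filter (χ · ∈ A.image χ) = A := by
    have := filter_mem_image_inter (e' := A) (h.injOn e he)
    rwa [inter_eq_right.2 hA] at this
  rw [← hfil]
  refine h.robust _ (hc _ (mem_image_of_mem _ hwA) fun hu ↦ hAe ?_) e he
  rw [← hfil, hu]
  simp

lemma card_filter_not_isCenter_le {k s m : ℕ} (hk : 5 ≤ k) (hs : 2 * k ≤ s) (hm : 1 ≤ m)
    (hs' : (m + 2) * (k + 1) ≤ s) : ∃ K : ℕ, ∀ {n : ℕ} (H : Finset (Finset (Fin n))),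
      (∀ e ∈ H, #e = k) → CycleFree k (m + 2) H →
      #(H.filter fun e ↦ ¬ ∃ w, IsCenter s H e w) ≤ K * n ^ (k - 2) := by
  have : NeZero k := ⟨by omega⟩
  obtain ⟨K, hK⟩ := exists_homogeneous k s
  refine ⟨K, fun {n} H hH hfree ↦ ?_⟩
  obtain ⟨χ, F, hF, J, hcard, h⟩ := hK (H.filter fun e ↦ ¬ ∃ w, IsCenter s H e w)
    fun e he ↦ hH e (mem_filter.1 he).1
  have hFH : F ⊆ H := hF.trans (filter_subset _ _)
  rcases F.eq_empty_or_nonempty with rfl | hne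
  · simp only [card_empty, mul_zero, Nat.le_zero] at hcard
    rw [hcard]
    exact Nat.zero_le _
  refine hcard.trans (Nat.mul_le_mul_left _ ?_)
  by_contra hlt
  push Not at hlt
  have hcov : ∀ a b, a ≠ b → ({a}ᶜ : Finset (Fin k)) ∈ J ∨ ({b}ᶜ : Finset (Fin k)) ∈ J ∨
      ({a, b}ᶜ : Finset (Fin k)) ∈ J := by
    intro a b hab
    by_contra hcon
    simp only [not_or] at hcon
    have hTcard : #({a, b}ᶜ : Finset (Fin k)) = k - 2 := by
      rw [card_compl, Fintype.card_fin, card_pair hab]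
    have := h.card_le_of_forall_not_subset (T := {a, b}ᶜ)
      (S := powersetCard (k - 2) univ) (by
        intro A hA hsub
        have hA' : Aᶜ ⊆ {a, b} := by
          rw [← compl_compl ({a, b} : Finset (Fin k))]
          exact compl_subset_compl.2 hsub
        have hcase : Aᶜ = ∅ ∨ Aᶜ = {a} ∨ Aᶜ = {b} ∨ Aᶜ = {a, b} := by
          have := coe_subset.2 hA'
          rw [coe_pair, Set.subset_pair_iff_eq] at this
          exact_mod_cast this
        have hAA := compl_compl A
        rcases hcase with h' | h' | h' | h' <;> rw [h'] at hAA
        · exact h.univ_notMem (by rwa [← hAA, compl_empty] at hA)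
        · exact hcon.1 (hAA ▸ hA)
        · exact hcon.2.1 (hAA ▸ hA)
        · exact hcon.2.2 (hAA ▸ hA)) (by
        intro e _ f _ hf
        rw [hTcard] at hf
        simp [hf])
    rw [card_powersetCard, card_univ, Fintype.card_fin] at this
    exact absurd (this.trans (Nat.choose_le_pow n (k - 2))) (by omega)
  rcases star_or_triangle hk (fun A hA B hB ↦ h.inter_mem hs hne hA hB) hcov with
    ⟨c, hc⟩ | ⟨T, hT, hTJ⟩
  · obtain ⟨e, he⟩ := hne
    obtain ⟨w, hw, hw'⟩ := h.isCenter hc he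
    exact (mem_filter.1 (hF he)).2 ⟨w, hw, fun A hA hwA hAe ↦ (hw' A hA hwA hAe).mono hFH⟩
  · exact hfree (h.exists_linearCycle hm (by omega) hH hs' hne hFH hT hTJ)

lemma card_le_mul_card_of_shadow_subset {k s m : ℕ} (hk : 3 ≤ k) (hs : 2 * k ≤ s) (hm : 1 ≤ m)
    (hs' : (m + 2) * (k + 1) ≤ s) : ∃ K : ℕ, ∀ {n : ℕ} (B : Finset (Finset (Fin n))),
      (∀ e ∈ B, #e = k) → CycleFree k (m + 2) B → ∀ S : Finset (Finset (Fin n)),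
      (∀ e ∈ B, ∀ f ⊆ e, #f = k - 1 → f ∈ S) → #B ≤ K * #S := by
  have : NeZero k := ⟨by omega⟩
  obtain ⟨K, hK⟩ := exists_homogeneous k s
  refine ⟨K, fun {n} B hB hfree S hS ↦ ?_⟩
  obtain ⟨χ, F, hF, J, hcard, h⟩ := hK B hB
  rcases F.eq_empty_or_nonempty with rfl | hne
  · exact hcard.trans (by simp)
  refine hcard.trans (Nat.mul_le_mul_left _ ?_)
  by_contra hlt
  have hmem : ∀ a, ({a}ᶜ : Finset (Fin k)) ∈ J := by
    intro a
    by_contra hcon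
    refine hlt (h.card_le_of_forall_not_subset (T := {a}ᶜ) ?_ fun e he f hf hfc ↦ ?_)
    · intro A hA hsub
      have hA' : Aᶜ ⊆ {a} := by
        rw [← compl_compl ({a} : Finset (Fin k))]
        exact compl_subset_compl.2 hsub
      have hAA := compl_compl A
      rcases subset_singleton_iff.1 hA' with h' | h' <;> rw [h'] at hAA
      · exact h.univ_notMem (by rwa [← hAA, compl_empty] at hA)
      · exact hcon (hAA ▸ hA)
    · rw [card_compl, Fintype.card_fin, card_singleton] at hfc
      exact hS e (hF he) f hf hfc
  obtain ⟨T, -, hT⟩ := exists_subset_card_eq (s := (univ : Finset (Fin k))) (n := 3) (by simpa)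
  refine hfree (h.exists_linearCycle hm hk hB hs' hne hF hT fun a _ b _ hab ↦ ?_)
  rw [← compl_compl ({a, b} : Finset (Fin k))]
  refine compl_mem_of_forall_mem (fun A hA B hB ↦ h.inter_mem hs hne hA hB) ?_
    fun c hc ↦ ⟨{c}, by simpa using hc, by simp, hmem c⟩
  rw [← card_pos, card_compl, Fintype.card_fin, card_pair hab]
  omega

/-- The vertices outside `S` forming a robust pair with every vertex of `S`. -/
noncomputable def robustNbrs {n : ℕ} (s : ℕ) (H : Finset (Finset (Fin n))) (S : Finset (Fin n)) :
    Finset (Fin n) :=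
  univ.filter fun v ↦ v ∉ S ∧ ∀ w ∈ S, Robust s H {v, w}

lemma exists_injOn_nat {α : Type} {S : Finset α} {m : ℕ} (hm : m ≤ #S) (hm0 : 0 < m) :
    ∃ g : ℕ → α, Set.InjOn g (Set.Iio m) ∧ ∀ i < m, g i ∈ S := by
  refine ⟨fun i ↦ if h : i < m then S.equivFin.symm ⟨i, by omega⟩ else
    S.equivFin.symm ⟨0, by omega⟩, fun i hi j hj hij ↦ ?_, fun i hi ↦ ?_⟩
  · have hi' : i < m := hi
    have hj' : j < m := hj
    simp only [hi', hj', dite_true] at hij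
    simpa using S.equivFin.symm.injective (Subtype.ext hij)
  · simp [hi]

lemma card_inter_robustNbrs_le {n k t s : ℕ} (ht : 1 ≤ t) (hk : 3 ≤ k)
    (hs : (2 * t + 1) * (k + 1) ≤ s) {H : Finset (Finset (Fin n))} (hH : ∀ e ∈ H, #e = k)
    (hfree : CycleFree k (2 * t + 1) H) {S : Finset (Fin n)} (hS : #S = t)
    (hX : t + k ≤ #(robustNbrs s H S)) {e : Finset (Fin n)} (he : e ∈ H) (heS : Disjoint e S) :
    #(e ∩ robustNbrs s H S) ≤ 1 := by
  by_contra hlt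
  push Not at hlt
  obtain ⟨p, hp, q, hq, hpq⟩ := one_lt_card.1 hlt
  obtain ⟨w, hw, hwS⟩ := exists_injOn_nat hS.ge ht
  obtain ⟨x, hx, hxX⟩ := exists_injOn_nat (S := robustNbrs s H S \ e) (m := t) (by
    have := le_card_sdiff e (robustNbrs s H S)
    rw [hH e he] at this
    omega) ht
  have hrob : ∀ v ∈ robustNbrs s H S, ∀ i < t, Robust s H {v, w i} := fun v hv i hi ↦
    (mem_filter.1 hv).2.2 _ (hwS i hi)
  have hnot : ∀ v ∈ robustNbrs s H S, ∀ i < t, v ≠ w i := fun v hv i hi h ↦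
    (mem_filter.1 hv).2.1 (h ▸ hwS i hi)
  rw [mem_inter] at hp hq
  have hxm : ∀ i < t, x i ∈ robustNbrs s H S ∧ x i ∉ e := fun i hi ↦ mem_sdiff.1 (hxX i hi)
  obtain ⟨r, rfl⟩ : ∃ r, t = r + 1 := ⟨t - 1, by omega⟩
  let u : ℕ → Fin n := fun j ↦ if j = r then q else x j
  have hu : Set.InjOn u (Set.Iio (r + 1)) := by
    intro i hi j hj hij
    have hi' : i < r + 1 := hi
    have hj' : j < r + 1 := hj
    simp only [u] at hij
    split_ifs at hij with h1 h2 h2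
    · omega
    · exact absurd (hij ▸ hq.1) (hxm j hj').2
    · exact absurd (hij ▸ hq.1) (hxm i hi').2
    · exact hx hi hj hij
  have huX : ∀ j < r + 1, u j ∈ robustNbrs s H S := by
    intro j hj
    simp only [u]
    split_ifs
    · exact hq.2
    · exact (hxm j hj).1
  let y : ℕ → Fin n := fun i ↦ if i % 2 = 0 then w (i / 2) else u (i / 2)
  have hlast : y (2 * r + 1) = q := by
    have h1 : (2 * r + 1) / 2 = r := by omega
    simp [y, u, h1]
  refine hfree (exists_linearCycle_of_path (m := 2 * r + 1) (y := y) (p := p) (by omega) hk hH hs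
    ?_ ?_ ?_ ?_ he hp.1 (hlast ▸ hq.1) ?_)
  · intro i hi j hj hij
    have hi' : i ≤ 2 * r + 1 := hi
    have hj' : j ≤ 2 * r + 1 := hj
    simp only [y] at hij
    split_ifs at hij with h1 h2 h2
    · have := hw (show i / 2 < r + 1 by omega) (show j / 2 < r + 1 by omega) hij
      omega
    · exact absurd hij.symm (hnot _ (huX (j / 2) (by omega)) _ (by omega))
    · exact absurd hij (hnot _ (huX (i / 2) (by omega)) _ (by omega))
    · have := hu (show i / 2 < r + 1 by omega) (show j / 2 < r + 1 by omega) hij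
      omega
  · intro i hi
    simp only [y, u]
    split_ifs with h1 h2
    · exact Ne.symm (hnot p hp.2 _ (by omega))
    · exact Ne.symm hpq
    · exact fun h ↦ (hxm (i / 2) (by omega)).2 (h ▸ hp.1)
  · exact hrob p hp.2 0 (by omega)
  · intro i hi
    simp only [y]
    by_cases h1 : i % 2 = 0
    · rw [if_pos h1, if_neg (by omega), pair_comm, show (i + 1) / 2 = i / 2 by omega]
      exact hrob _ (huX _ (by omega)) _ (by omega)
    · rw [if_neg h1, if_pos (by omega)]
      exact hrob _ (huX _ (by omega)) _ (by omega)
  · intro i hi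
    simp only [y, u]
    split_ifs with h1 h2
    · exact fun h ↦ disjoint_left.1 heS h (hwS _ (by omega))
    · omega
    · exact (hxm (i / 2) (by omega)).2

/-- Pairs `(x, w)` such that some edge centred at `w` contains both `p` and `x`. -/
noncomputable def centerPairs {n : ℕ} (s : ℕ) (H : Finset (Finset (Fin n))) (p : Fin n) :
    Finset (Fin n × Fin n) :=
  univ.filter fun q ↦ q.1 ≠ p ∧ q.1 ≠ q.2 ∧ p ≠ q.2 ∧
    ∃ e ∈ H, IsCenter s H e q.2 ∧ p ∈ e ∧ q.1 ∈ e

lemma card_centerPairs_le {n k t s : ℕ} (ht : 1 ≤ t) (hk : 4 ≤ k)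
    (hs : (2 * t + 1) * (k + 1) ≤ s) {H : Finset (Finset (Fin n))} (hH : ∀ e ∈ H, #e = k)
    (hfree : CycleFree k (2 * t + 1) H) (p : Fin n) : #(centerPairs s H p) ≤ 4 * t * n := by
  obtain ⟨t, rfl⟩ : ∃ r, t = r + 1 := ⟨t - 1, by omega⟩
  obtain ⟨r, hr⟩ : ∃ r : Fin n ⊕ Fin n → Fin n × Fin n → Prop, ∀ i q, r i q ↔
    Sum.elim (fun x ↦ q.1 = x) (fun w ↦ q.2 = w) i := ⟨_, fun _ _ ↦ Iff.rfl⟩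
  obtain ⟨Q, hQ, R, -, hRbad, hcard, hgood⟩ := exists_clean_subset r
    (fun _ X ↦ #X ≤ 2 * (t + 1)) univ (centerPairs s H p)
  rcases Q.eq_empty_or_nonempty with rfl | ⟨q₀, hq₀⟩
  · refine hcard.trans ?_
    have := sum_le_card_nsmul univ (fun i ↦ #(R i)) (2 * (t + 1)) (by
      intro i hi
      rcases hRbad i hi with h | h
      · simp [h]
      · exact h)
    rw [card_univ, Fintype.card_sum, Fintype.card_fin, smul_eq_mul] at this
    rw [card_empty]
    linarith
  exfalso
  have hQ' : ∀ {x w}, (x, w) ∈ Q → x ≠ p ∧ x ≠ w ∧ p ≠ w ∧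
      Robust s H {x, w} ∧ Robust s H {p, w} ∧ Robust s H {p, x, w} := by
    intro x w hxw
    obtain ⟨-, h1, h2, h3, e, he, ⟨hw, hc⟩, hp, hx⟩ := mem_filter.1 (hQ hxw)
    have hek := hH e he
    have hne : ∀ A : Finset (Fin n), #A ≤ 3 → A ≠ e := by
      rintro A hA rfl
      omega
    refine ⟨h1, h2, h3, hc _ ?_ (by simp) (hne _ (card_le_two.trans (by omega))),
      hc _ ?_ (by simp) (hne _ (card_le_two.trans (by omega))), hc _ ?_ (by simp)
      (hne _ card_le_three)⟩
    all_goals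
      intro v hv
      simp only [mem_insert, mem_singleton] at hv
      rcases hv with rfl | hv
      · assumption
      · first
        | (subst hv; assumption)
        | (rcases hv with rfl | rfl <;> assumption)
  have hleft : ∀ {x w}, (x, w) ∈ Q → ∀ Z : Finset (Fin n), #Z ≤ 2 * (t + 1) →
      ∃ w' ∉ Z, (x, w') ∈ Q := by
    intro x w hxw Z hZ
    have h1 := hgood (Sum.inl x) (mem_univ _) _ hxw ((hr _ _).2 rfl)
    have h2 : #((Q.filter (r (Sum.inl x))).image Prod.snd) = #(Q.filter (r (Sum.inl x))) := by
      refine card_image_of_injOn ?_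
      intro a ha b hb hab
      have ha' := (hr _ _).1 (mem_filter.1 ha).2
      have hb' := (hr _ _).1 (mem_filter.1 hb).2
      exact Prod.ext (ha'.trans hb'.symm) hab
    obtain ⟨w', hw', hw'Z⟩ := exists_mem_notMem_of_card_lt_card
      (show #Z < #((Q.filter (r (Sum.inl x))).image Prod.snd) by omega)
    obtain ⟨⟨x', w''⟩, hq, rfl⟩ := mem_image.1 hw'
    rw [mem_filter, hr] at hq
    obtain ⟨hq, hqx⟩ := hq
    have : x' = x := hqx
    subst this
    exact ⟨_, hw'Z, hq⟩
  have hright : ∀ {x w}, (x, w) ∈ Q → ∀ Z : Finset (Fin n), #Z ≤ 2 * (t + 1) →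
      ∃ x' ∉ Z, (x', w) ∈ Q := by
    intro x w hxw Z hZ
    have h1 := hgood (Sum.inr w) (mem_univ _) _ hxw ((hr _ _).2 rfl)
    have h2 : #((Q.filter (r (Sum.inr w))).image Prod.fst) = #(Q.filter (r (Sum.inr w))) := by
      refine card_image_of_injOn ?_
      intro a ha b hb hab
      have ha' := (hr _ _).1 (mem_filter.1 ha).2
      have hb' := (hr _ _).1 (mem_filter.1 hb).2
      exact Prod.ext hab (ha'.trans hb'.symm)
    obtain ⟨w', hw', hw'Z⟩ := exists_mem_notMem_of_card_lt_card
      (show #Z < #((Q.filter (r (Sum.inr w))).image Prod.fst) by omega)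
    obtain ⟨⟨x', w''⟩, hq, rfl⟩ := mem_image.1 hw'
    rw [mem_filter, hr] at hq
    obtain ⟨hq, hqx⟩ := hq
    have : w'' = w := hqx
    subst this
    exact ⟨_, hw'Z, hq⟩
  obtain ⟨y, hy, -, hInv, hR⟩ := exists_greedy_seq (N := 2 * (t + 1))
    (Inv := fun i v ↦ if i % 2 = 0 then ∃ x, (x, v) ∈ Q else ∃ w, (v, w) ∈ Q)
    (R := fun i u v ↦ if i % 2 = 0 then (v, u) ∈ Q else (u, v) ∈ Q) (y₀ := q₀.2) (by
      simpa using ⟨q₀.1, hq₀⟩) (by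
      intro i v hv Z hZ _
      by_cases hi : i % 2 = 0
      · rw [if_pos hi] at hv
        obtain ⟨x, hx⟩ := hv
        obtain ⟨x', hx'Z, hx'⟩ := hright hx Z hZ
        refine ⟨x', hx'Z, (hQ' hx').2.1, ?_, ?_⟩
        · rw [if_neg (by omega)]
          exact ⟨v, hx'⟩
        · rwa [if_pos hi]
      · rw [if_neg hi] at hv
        obtain ⟨w, hw⟩ := hv
        obtain ⟨w', hw'Z, hw'⟩ := hleft hw Z hZ
        refine ⟨w', hw'Z, (hQ' hw').2.1.symm, ?_, ?_⟩
        · rw [if_pos (by omega)]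
          exact ⟨v, hw'⟩
        · rwa [if_neg hi]) (2 * (t + 1)) le_rfl
  have hyp : ∀ i ≤ 2 * (t + 1), y i ≠ p := by
    intro i hi
    have := hInv i hi
    split_ifs at this
    · obtain ⟨x, hx⟩ := this
      exact (hQ' hx).2.2.1.symm
    · obtain ⟨w, hw⟩ := this
      exact (hQ' hw).1
  have hend : (y (2 * t + 1), y (2 * t + 2)) ∈ Q := by
    have := hR (2 * t + 1) (by omega)
    rwa [if_neg (by omega)] at this
  refine hfree (exists_linearCycle_of_robust (m := 2 * t + 1) (p := p) (y := y) (by omega)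
    (by omega) hH hs (hy.mono ?_) (fun i hi ↦ hyp i (by omega)) ?_ ?_
    (hQ' hend).2.2.2.2.2 (by simp) (by simp) ?_)
  · intro i hi
    have : i ≤ 2 * t + 1 := hi
    exact show i ≤ _ by omega
  · have := hInv 0 (by omega)
    rw [if_pos rfl] at this
    obtain ⟨x, hx⟩ := this
    exact (hQ' hx).2.2.2.2.1
  · intro i hi
    have := hR i (by omega)
    split_ifs at this
    · rw [pair_comm]
      exact (hQ' this).2.2.2.1
    · exact (hQ' this).2.2.2.1
  · intro i hi hmem
    simp only [mem_insert, mem_singleton] at hmem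
    rcases hmem with h | h | h
    · exact hyp i (by omega) h
    · have := hy (show i ≤ 2 * (t + 1) by omega) (show 2 * t + 1 ≤ 2 * (t + 1) by omega) h
      omega
    · have := hy (show i ≤ 2 * (t + 1) by omega) (show 2 * t + 2 ≤ 2 * (t + 1) by omega) h
      omega

end CycleFree

section Counting

lemma choose_succ_le_choose_sub_add (n r j : ℕ) :
    n.choose (r + 1) ≤ (n - j).choose (r + 1) + j * n ^ r := by
  induction j with
  | zero => simp
  | succ j ih =>
    have h : (n - j).choose (r + 1) ≤ (n - (j + 1)).choose (r + 1) + n ^ r := by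
      rcases h : n - j with _ | a
      · simp
      · rw [Nat.choose_succ_succ, show n - (j + 1) = a by omega, add_comm]
        gcongr
        exact (Nat.choose_le_pow a r).trans (Nat.pow_le_pow_left (by omega) r)
    rw [add_mul, one_mul]
    omega

lemma mul_choose_add_choose_sub_le {n t : ℕ} (r : ℕ) (ht : t ≤ n) :
    t * n.choose (r + 1) + (n - t).choose (r + 2) ≤ n.choose (r + 2) + t ^ 2 * n ^ r := by
  induction t with
  | zero => simp
  | succ t ih =>
    have h1 := ih (by omega)
    have h2 := choose_succ_le_choose_sub_add n r (t + 1)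
    have h3 : (n - t).choose (r + 2) =
        (n - (t + 1)).choose (r + 1) + (n - (t + 1)).choose (r + 2) := by
      rw [show n - t = n - (t + 1) + 1 by omega, Nat.choose_succ_succ]
    nlinarith [Nat.zero_le (n ^ r * t)]

lemma pow_le_descFactorial_add (n r : ℕ) :
    n ^ r ≤ n.descFactorial r + r ^ 2 * n ^ (r - 1) := by
  induction r with
  | zero => simp
  | succ r ih =>
    have h1 : n * (r ^ 2 * n ^ (r - 1)) = r ^ 2 * n ^ r := by
      rcases r with _ | r
      · simp
      · rw [Nat.add_sub_cancel]
        ring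
    have h2 : n * n.descFactorial r ≤ n.descFactorial (r + 1) + r * n ^ r := by
      rw [Nat.descFactorial_succ]
      calc n * n.descFactorial r ≤ (n - r + r) * n.descFactorial r := by gcongr; omega
        _ ≤ _ := by
          rw [add_mul]
          gcongr
          exact Nat.descFactorial_le_pow n r
    calc n ^ (r + 1) = n * n ^ r := by ring
      _ ≤ n * (n.descFactorial r + r ^ 2 * n ^ (r - 1)) := by gcongr
      _ ≤ n.descFactorial (r + 1) + r * n ^ r + r ^ 2 * n ^ r := by
        rw [mul_add, h1]
        gcongr
      _ ≤ _ := by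
        rw [Nat.add_sub_cancel]
        nlinarith [Nat.zero_le (r * n ^ r), Nat.zero_le (n ^ r)]

/-- Sets of size `r + 1` with at most one element in `X` are determined by an element and an
`r`-set outside `X`. -/
lemma card_le_of_forall_card_inter_le_one {n r : ℕ} {𝒜 : Finset (Finset (Fin n))}
    {X : Finset (Fin n)} (h𝒜 : ∀ f ∈ 𝒜, #f = r + 1) (hX : ∀ f ∈ 𝒜, #(f ∩ X) ≤ 1) :
    #𝒜 ≤ n * #Xᶜ ^ r := by
  have hsub : 𝒜 ⊆ ((univ : Finset (Fin n)) ×ˢ powersetCard r Xᶜ).image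
      fun q ↦ insert q.1 q.2 := by
    intro f hf
    have hfc := h𝒜 f hf
    obtain ⟨v, hv, hvX⟩ : ∃ v ∈ f, f ∩ X ⊆ {v} := by
      rcases (f ∩ X).eq_empty_or_nonempty with h | ⟨v, hv⟩
      · obtain ⟨v, hv⟩ := card_pos.1 (show 0 < #f by omega)
        exact ⟨v, hv, by simp [h]⟩
      · exact ⟨v, (mem_inter.1 hv).1, fun u hu ↦
          mem_singleton.2 (card_le_one.1 (hX f hf) u hu v hv)⟩
    refine mem_image.2 ⟨(v, f.erase v), mem_product.2 ⟨mem_univ _, mem_powersetCard.2 ⟨?_, ?_⟩⟩,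
      insert_erase hv⟩
    · intro u hu
      rw [mem_erase] at hu
      exact mem_compl.2 fun huX ↦ hu.1 (mem_singleton.1 (hvX (mem_inter.2 ⟨hu.2, huX⟩)))
    · rw [card_erase_of_mem hv, hfc, Nat.add_sub_cancel]
  calc #𝒜 ≤ _ := card_le_card hsub
    _ ≤ _ := card_image_le
    _ = n * (#Xᶜ).choose r := by simp
    _ ≤ _ := by gcongr; exact Nat.choose_le_pow _ _

lemma card_filter_not_disjoint_le (n r : ℕ) (L : Finset (Fin n)) :
    #((powersetCard (r + 1) (univ : Finset (Fin n))).filter fun f ↦ ¬ Disjoint f L) ≤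
      #L * n ^ r := by
  have hsub : ((powersetCard (r + 1) (univ : Finset (Fin n))).filter fun f ↦ ¬ Disjoint f L) ⊆
      (L ×ˢ powersetCard r univ).image fun q ↦ insert q.1 q.2 := by
    intro f hf
    obtain ⟨hf, hfL⟩ := mem_filter.1 hf
    obtain ⟨v, hv, hvL⟩ := not_disjoint_iff.1 hfL
    refine mem_image.2 ⟨(v, f.erase v), mem_product.2 ⟨hvL, mem_powersetCard.2 ⟨subset_univ _, ?_⟩⟩,
      insert_erase hv⟩
    rw [card_erase_of_mem hv, (mem_powersetCard.1 hf).2, Nat.add_sub_cancel]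
  calc _ ≤ _ := card_le_card hsub
    _ ≤ _ := card_image_le
    _ = #L * n.choose r := by simp
    _ ≤ _ := by gcongr; exact Nat.choose_le_pow _ _

end Counting

section Centers

/-- Pairs `(p, x)` such that some edge centred at `w` contains both `p` and `x`. -/
noncomputable def centerLinks {n : ℕ} (s : ℕ) (H : Finset (Finset (Fin n))) (w : Fin n) :
    Finset (Fin n × Fin n) :=
  univ.filter fun q ↦ (q.2, w) ∈ centerPairs s H q.1

lemma sum_card_centerLinks {n s : ℕ} (H : Finset (Finset (Fin n))) :
    ∑ w, #(centerLinks s H w) = ∑ p, #(centerPairs s H p) := by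
  have h1 : ∀ w, #(centerLinks s H w) =
      ∑ p, ∑ x, if (x, w) ∈ centerPairs s H p then 1 else 0 := by
    intro w
    rw [centerLinks, card_filter, Fintype.sum_prod_type]
  have h2 : ∀ p, #(centerPairs s H p) =
      ∑ x, ∑ w, if (x, w) ∈ centerPairs s H p then 1 else 0 := by
    intro p
    rw [← Fintype.sum_prod_type' (f := fun x w ↦ if (x, w) ∈ centerPairs s H p then 1 else 0),
      ← card_filter]
    simp
  simp_rw [h1, h2]
  rw [sum_comm]
  exact sum_congr rfl fun p _ ↦ sum_comm

lemma card_filter_isCenter_le {n k s : ℕ} (hk : 5 ≤ k) {H : Finset (Finset (Fin n))}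
    (hH : ∀ e ∈ H, #e = k) (w : Fin n) :
    #(H.filter fun e ↦ IsCenter s H e w) ≤ #(centerLinks s H w) ^ 2 * n ^ (k - 5) := by
  have hsub : (H.filter fun e ↦ IsCenter s H e w) ⊆
      ((centerLinks s H w ×ˢ centerLinks s H w) ×ˢ powersetCard (k - 5) univ).image
        fun q ↦ ((insert w q.2 ∪ {q.1.1.1, q.1.1.2}) ∪ {q.1.2.1, q.1.2.2}) := by
    intro e he
    obtain ⟨he, hc⟩ := mem_filter.1 he
    have hek := hH e he
    have hlink : ∀ U ⊆ e.erase w, ∀ x y, x ≠ y → U = {x, y} → (x, y) ∈ centerLinks s H w := by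
      rintro U hU x y hxy rfl
      have hx := mem_erase.1 (hU (mem_insert_self x {y}))
      have hy := mem_erase.1 (hU (mem_insert_of_mem (mem_singleton_self y)))
      simp only [centerLinks, centerPairs, mem_filter, mem_univ, true_and]
      exact ⟨hxy.symm, hy.1, hx.1, e, he, hc, hx.2, hy.2⟩
    have hew : #(e.erase w) = k - 1 := by rw [card_erase_of_mem hc.1, hek]
    obtain ⟨U, hU, hUc⟩ := exists_subset_card_eq (show 2 ≤ #(e.erase w) by omega)
    have hsd : #(e.erase w \ U) = k - 3 := by
      rw [card_sdiff_of_subset hU, hew, hUc]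
      omega
    obtain ⟨V, hV, hVc⟩ := exists_subset_card_eq (show 2 ≤ #(e.erase w \ U) by omega)
    obtain ⟨x, y, hxy, hUxy⟩ := card_eq_two.1 hUc
    obtain ⟨x', y', hxy', hVxy⟩ := card_eq_two.1 hVc
    refine mem_image.2 ⟨(((x, y), (x', y')), (e.erase w \ U) \ V), ?_, ?_⟩
    · refine mem_product.2 ⟨mem_product.2 ⟨hlink U hU x y hxy hUxy,
        hlink V (hV.trans sdiff_subset) x' y' hxy' hVxy⟩,
        mem_powersetCard.2 ⟨subset_univ _, ?_⟩⟩
      rw [card_sdiff_of_subset hV, hsd, hVc]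
      omega
    · simp only [← hUxy, ← hVxy]
      ext v
      have h1 := @hU v
      have h2 := @hV v
      have h3 := hc.1
      simp only [mem_union, mem_insert, mem_sdiff, mem_erase] at h1 h2 ⊢
      by_cases hvw : v = w
      · subst hvw
        tauto
      · tauto
  calc _ ≤ _ := card_le_card hsub
    _ ≤ _ := card_image_le
    _ = #(centerLinks s H w) ^ 2 * n.choose (k - 5) := by simp [sq]
    _ ≤ _ := by gcongr; exact Nat.choose_le_pow _ _

lemma exists_card_filter_not_isCenter_mem_le {k t s : ℕ} (hk : 5 ≤ k) (ht : 1 ≤ t)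
    (hs : 2 * k ≤ s) (hs' : (2 * t + 1) * (k + 1) ≤ s) :
    ∃ K : ℕ, ∀ {n : ℕ} (H : Finset (Finset (Fin n))) (N : ℕ), 1 ≤ n →
      (∀ e ∈ H, #e = k) → CycleFree k (2 * t + 1) H →
      ∃ L : Finset (Fin n), #L ≤ 4 * t * N ∧
        N * #(H.filter fun e ↦ ¬ ∃ w ∈ L, IsCenter s H e w) ≤
          N * (K * n ^ (k - 2)) + 4 * t * n ^ (k - 1) := by
  obtain ⟨K, hK⟩ : ∃ K : ℕ, ∀ {n : ℕ} (H : Finset (Finset (Fin n))),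
      (∀ e ∈ H, #e = k) → CycleFree k (2 * t + 1) H →
      #(H.filter fun e ↦ ¬ ∃ w, IsCenter s H e w) ≤ K * n ^ (k - 2) := by
    obtain ⟨r, rfl⟩ : ∃ r, t = r + 1 := ⟨t - 1, by omega⟩
    exact card_filter_not_isCenter_le (m := 2 * r + 1) hk hs (by omega) hs'
  refine ⟨K, fun {n} H N hn hH hfree ↦ ?_⟩
  have hsum : ∑ w, #(centerLinks s H w) ≤ 4 * t * n ^ 2 := by
    rw [sum_card_centerLinks]
    calc _ ≤ ∑ _p : Fin n, 4 * t * n :=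
        sum_le_sum fun p _ ↦ card_centerPairs_le ht (by omega) hs' hH hfree p
      _ = _ := by simp; ring
  set L : Finset (Fin n) := univ.filter fun w ↦ n ^ 2 < N * #(centerLinks s H w) with hL
  refine ⟨L, ?_, ?_⟩
  · refine Nat.le_of_mul_le_mul_right (c := n ^ 2) ?_ (by positivity)
    calc #L * n ^ 2 = ∑ _w ∈ L, n ^ 2 := by simp
      _ ≤ ∑ w ∈ L, N * #(centerLinks s H w) := sum_le_sum fun w hw ↦ (mem_filter.1 hw).2.le
      _ ≤ ∑ w, N * #(centerLinks s H w) := sum_le_univ_sum_of_nonneg fun _ ↦ Nat.zero_le _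
      _ = N * ∑ w, #(centerLinks s H w) := (mul_sum _ _ _).symm
      _ ≤ N * (4 * t * n ^ 2) := by gcongr
      _ = _ := by ring
  · have hsub : (H.filter fun e ↦ ¬ ∃ w ∈ L, IsCenter s H e w) ⊆
        (H.filter fun e ↦ ¬ ∃ w, IsCenter s H e w) ∪
          Lᶜ.biUnion fun w ↦ H.filter fun e ↦ IsCenter s H e w := by
      intro e he
      obtain ⟨he, hne⟩ := mem_filter.1 he
      rw [mem_union, mem_filter, mem_biUnion]
      by_cases h : ∃ w, IsCenter s H e w
      · obtain ⟨w, hw⟩ := h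
        exact Or.inr ⟨w, mem_compl.2 fun hwL ↦ hne ⟨w, hwL, hw⟩, mem_filter.2 ⟨he, hw⟩⟩
      · exact Or.inl ⟨he, h⟩
    have hlow : N * ∑ w ∈ Lᶜ, #(H.filter fun e ↦ IsCenter s H e w) ≤ 4 * t * n ^ (k - 1) := by
      calc N * ∑ w ∈ Lᶜ, #(H.filter fun e ↦ IsCenter s H e w)
          = ∑ w ∈ Lᶜ, N * #(H.filter fun e ↦ IsCenter s H e w) := mul_sum _ _ _
        _ ≤ ∑ w ∈ Lᶜ, #(centerLinks s H w) * n ^ (k - 3) := by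
          refine sum_le_sum fun w hw ↦ ?_
          have hw' : N * #(centerLinks s H w) ≤ n ^ 2 := by simpa [hL] using hw
          calc _ ≤ N * (#(centerLinks s H w) ^ 2 * n ^ (k - 5)) := by
                gcongr
                exact card_filter_isCenter_le hk hH w
            _ = (N * #(centerLinks s H w)) * (#(centerLinks s H w) * n ^ (k - 5)) := by ring
            _ ≤ n ^ 2 * (#(centerLinks s H w) * n ^ (k - 5)) := by gcongr
            _ = #(centerLinks s H w) * n ^ (2 + (k - 5)) := by ring
            _ = _ := by rw [show 2 + (k - 5) = k - 3 by omega]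
        _ ≤ ∑ w, #(centerLinks s H w) * n ^ (k - 3) :=
          sum_le_univ_sum_of_nonneg fun _ ↦ Nat.zero_le _
        _ = (∑ w, #(centerLinks s H w)) * n ^ (k - 3) := (sum_mul _ _ _).symm
        _ ≤ (4 * t * n ^ 2) * n ^ (k - 3) := by gcongr
        _ = 4 * t * n ^ (2 + (k - 3)) := by ring
        _ = _ := by rw [show 2 + (k - 3) = k - 1 by omega]
    calc _ ≤ N * (K * n ^ (k - 2) + ∑ w ∈ Lᶜ, #(H.filter fun e ↦ IsCenter s H e w)) := by
          gcongr
          exact (card_le_card hsub).trans ((card_union_le _ _).trans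
            (add_le_add (hK H hH hfree) card_biUnion_le))
      _ ≤ _ := by
        rw [mul_add]
        gcongr

end Centers

section Stability

/-- The vertices of `L` that extend `f` to an edge centred at them. -/
noncomputable def centerSet {n : ℕ} (s : ℕ) (H : Finset (Finset (Fin n))) (L f : Finset (Fin n)) :
    Finset (Fin n) :=
  L.filter fun w ↦ w ∉ f ∧ insert w f ∈ H ∧ IsCenter s H (insert w f) w

/-- The `r`-sets disjoint from `L` whose centre set has size `t` and `m` robust neighbours. -/
noncomputable def typicalSets {n : ℕ} (s : ℕ) (H : Finset (Finset (Fin n))) (L : Finset (Fin n))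
    (r t m : ℕ) : Finset (Finset (Fin n)) :=
  (powersetCard r univ).filter fun f ↦ Disjoint f L ∧ #(centerSet s H L f) = t ∧
    m ≤ #(robustNbrs s H (centerSet s H L f))

/-- The `k`-sets that meet `S` but do not belong to `H`. -/
noncomputable def missingSets {n : ℕ} (k : ℕ) (H : Finset (Finset (Fin n))) (S : Finset (Fin n)) :
    Finset (Finset (Fin n)) :=
  (powersetCard k univ).filter fun e ↦ ¬ Disjoint e S ∧ e ∉ H

variable {n s : ℕ} {H : Finset (Finset (Fin n))} {L f S : Finset (Fin n)}

lemma subset_robustNbrs (hf : 2 ≤ #f) (hS : S ⊆ centerSet s H L f) : f ⊆ robustNbrs s H S := by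
  intro v hv
  refine mem_filter.2 ⟨mem_univ _, fun hvS ↦ (mem_filter.1 (hS hvS)).2.1 hv, fun w hw ↦ ?_⟩
  obtain ⟨-, hwf, -, -, hc⟩ := mem_filter.1 (hS hw)
  refine hc _ ?_ (by simp) fun h ↦ ?_
  · rw [insert_subset_iff, singleton_subset_iff]
    exact ⟨mem_insert_of_mem hv, mem_insert_self _ _⟩
  · have := card_insert_of_notMem hwf
    rw [← h] at this
    have := card_le_two (a := v) (b := w)
    omega

lemma card_inter_robustNbrs_le_of_mem_centerSet {k t : ℕ} (ht : 1 ≤ t) (hk : 3 ≤ k)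
    (hs : (2 * t + 1) * (k + 1) ≤ s) (hH : ∀ e ∈ H, #e = k)
    (hfree : CycleFree k (2 * t + 1) H) (hS : #S = t) (hX : t + k ≤ #(robustNbrs s H S))
    {w : Fin n} (hw : w ∈ centerSet s H L f) (hwS : w ∉ S) (hfS : Disjoint f S) :
    #(f ∩ robustNbrs s H S) ≤ 1 := by
  obtain ⟨-, -, he, -⟩ := mem_filter.1 hw
  refine (card_le_card (inter_subset_inter_right (subset_insert w f))).trans
    (card_inter_robustNbrs_le ht hk hs hH hfree hS hX he ?_)
  rw [disjoint_insert_left]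
  exact ⟨hwS, hfS⟩

lemma card_filter_isCenter_mem_le_sum {r : ℕ} (hH : ∀ e ∈ H, #e = r + 1) :
    #(H.filter fun e ↦ ∃ w ∈ L, IsCenter s H e w) ≤
      ∑ f ∈ powersetCard r univ, #(centerSet s H L f) := by
  rw [← card_sigma]
  refine (card_le_card (t := ((powersetCard r univ).sigma fun f ↦ centerSet s H L f).image
    fun q ↦ insert q.2 q.1) ?_).trans card_image_le
  intro e he
  obtain ⟨he, w, hwL, hw⟩ := mem_filter.1 he
  refine mem_image.2 ⟨⟨e.erase w, w⟩, mem_sigma.2 ⟨mem_powersetCard.2 ⟨subset_univ _, ?_⟩, ?_⟩,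
    insert_erase hw.1⟩
  · rw [card_erase_of_mem hw.1, hH e he, Nat.add_sub_cancel]
  · simp only [centerSet, mem_filter, insert_erase hw.1]
    exact ⟨hwL, notMem_erase _ _, he, hw⟩

lemma sum_card_centerSet_le {r t : ℕ} (ht : 1 ≤ t) (hr : 2 ≤ r)
    (hs : (2 * t + 1) * (r + 3) ≤ s) (hH : ∀ e ∈ H, #e = r + 2)
    (hfree : CycleFree (r + 2) (2 * t + 1) H) :
    ∑ f ∈ powersetCard (r + 1) univ, #(centerSet s H L f) ≤
      (t - 1) * n.choose (r + 1) + #(typicalSets s H L (r + 1) t (t + (r + 2))) +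
        #L * (#L * n ^ r + 2 ^ #L * (t + (r + 2)) ^ (r + 1)) := by
  set P : Finset (Finset (Fin n)) := powersetCard (r + 1) univ with hP
  set G := typicalSets s H L (r + 1) t (t + (r + 2)) with hG
  set D : Finset (Finset (Fin n)) := P.filter (fun f ↦ ¬ Disjoint f L) with hD
  set Q : Finset (Finset (Fin n)) := ((powersetCard t L).filter fun S ↦
    #(robustNbrs s H S) < t + (r + 2)).biUnion
      fun S ↦ powersetCard (r + 1) (robustNbrs s H S) with hQ
  have hPc : #P = n.choose (r + 1) := by simp [hP]
  have hDc : #D ≤ #L * n ^ r := card_filter_not_disjoint_le n r L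
  have hQc : #Q ≤ 2 ^ #L * (t + (r + 2)) ^ (r + 1) := by
    refine (card_biUnion_le_card_mul _ _ ((t + (r + 2)) ^ (r + 1)) fun S hS ↦ ?_).trans ?_
    · rw [card_powersetCard]
      exact (Nat.choose_le_pow _ _).trans (Nat.pow_le_pow_left (mem_filter.1 hS).2.le _)
    · gcongr
      refine (card_filter_le _ _).trans ?_
      rw [card_powersetCard]
      exact Nat.choose_le_two_pow _ _
  have hpt : ∀ f ∈ P, #(centerSet s H L f) ≤
      (t - 1) + (if f ∈ G then 1 else 0) + #L * (if f ∈ D ∪ Q then 1 else 0) := by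
    intro f hf
    have hfc := (mem_powersetCard.1 hf).2
    have hTL : #(centerSet s H L f) ≤ #L := card_le_card (filter_subset _ _)
    by_cases hfDQ : f ∈ D ∪ Q
    · simp only [hfDQ, if_true]
      omega
    by_cases hlt : #(centerSet s H L f) < t
    · omega
    obtain ⟨S, hS, hSc⟩ := exists_subset_card_eq (show t ≤ #(centerSet s H L f) by omega)
    have hfX := subset_robustNbrs (by omega) hS
    have hfd : Disjoint f L := by
      by_contra h
      exact hfDQ (mem_union_left _ (mem_filter.2 ⟨hf, h⟩))
    have hSL : S ⊆ L := hS.trans (filter_subset _ _)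
    have hX : t + (r + 2) ≤ #(robustNbrs s H S) := by
      by_contra h
      exact hfDQ (mem_union_right _ (mem_biUnion.2 ⟨S, mem_filter.2
        ⟨mem_powersetCard.2 ⟨hSL, hSc⟩, by omega⟩, mem_powersetCard.2 ⟨hfX, hfc⟩⟩))
    have hTS : centerSet s H L f = S := by
      refine (subset_antisymm hS fun w hw ↦ ?_).symm
      by_contra hwS
      have := card_inter_robustNbrs_le_of_mem_centerSet ht (by omega) hs hH hfree hSc hX hw hwS
        (hfd.mono_right hSL)
      rw [inter_eq_left.2 hfX] at this
      omega
    have hfG : f ∈ G := mem_filter.2 ⟨hf, hfd, by rw [hTS, hSc], by rwa [hTS]⟩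
    simp only [hfG, if_true, hTS, hSc]
    omega
  refine (sum_le_sum hpt).trans ?_
  rw [sum_add_distrib, sum_add_distrib, sum_const, smul_eq_mul, ← mul_sum, ← card_filter,
    ← card_filter, hPc, mul_comm]
  gcongr
  · exact fun f hf ↦ (mem_filter.1 hf).2
  · refine (card_le_card fun f hf ↦ (mem_filter.1 hf).2).trans ((card_union_le D Q).trans ?_)
    omega

/-- Typical sets sharing two elements have the same centre set, so they are few when all
robust neighbourhoods are small. -/
lemma card_typicalSets_mul_factorial_le {r t m : ℕ} (ht : 1 ≤ t)
    (hs : (2 * t + 1) * (r + 5) ≤ s) (hH : ∀ e ∈ H, #e = r + 4)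
    (hfree : CycleFree (r + 4) (2 * t + 1) H)
    (hm : ∀ f ∈ typicalSets s H L (r + 3) t (t + (r + 4)),
      #(robustNbrs s H (centerSet s H L f)) ≤ m) :
    #(typicalSets s H L (r + 3) t (t + (r + 4))) * (r + 3).factorial ≤ n ^ 2 * m ^ (r + 1) := by
  set G := typicalSets s H L (r + 3) t (t + (r + 4)) with hG
  have hpair : ∀ q : Fin n × Fin n, q.1 ≠ q.2 →
      #(G.filter fun f ↦ q.1 ∈ f ∧ q.2 ∈ f) ≤ m.choose (r + 1) := by
    rintro ⟨x, y⟩ hxy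
    rcases (G.filter fun f ↦ x ∈ f ∧ y ∈ f).eq_empty_or_nonempty with h | ⟨f₀, hf₀⟩
    · simp [h]
    obtain ⟨hf₀, hx₀, hy₀⟩ := mem_filter.1 hf₀
    obtain ⟨hf₀P, hf₀L, hf₀t, hf₀X⟩ := mem_filter.1 hf₀
    have hf₀c := (mem_powersetCard.1 hf₀P).2
    have hf₀s := subset_robustNbrs (S := centerSet s H L f₀) (by omega) subset_rfl
    have hsame : ∀ f ∈ G, x ∈ f → y ∈ f → f ⊆ robustNbrs s H (centerSet s H L f₀) := by
      intro f hf hx hy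
      obtain ⟨hfP, hfL, hft, hfX⟩ := mem_filter.1 hf
      have hfc := (mem_powersetCard.1 hfP).2
      refine subset_robustNbrs (L := L) (by omega) ?_
      suffices h : centerSet s H L f ⊆ centerSet s H L f₀ from
        (eq_of_subset_of_card_le h (by omega)).ge
      intro w hw
      by_contra hw₀
      have := card_inter_robustNbrs_le_of_mem_centerSet ht (by omega) hs hH hfree hf₀t hf₀X hw hw₀
        (hfL.mono_right (filter_subset _ _))
      exact hxy (card_le_one.1 this x (mem_inter.2 ⟨hx, hf₀s hx₀⟩) y
        (mem_inter.2 ⟨hy, hf₀s hy₀⟩))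
    calc #(G.filter fun f ↦ x ∈ f ∧ y ∈ f)
        ≤ #(powersetCard (r + 1) (robustNbrs s H (centerSet s H L f₀))) := by
          refine card_le_card_of_injOn (fun f ↦ f \ {x, y}) (fun f hf ↦ ?_) ?_
          · obtain ⟨hf, hx, hy⟩ := mem_filter.1 hf
            have hfc := (mem_powersetCard.1 (mem_filter.1 hf).1).2
            refine mem_coe.2 (mem_powersetCard.2 ⟨sdiff_subset.trans (hsame f hf hx hy), ?_⟩)
            rw [card_sdiff_of_subset (by simp [insert_subset_iff, hx, hy]), hfc, card_pair hxy]
            omega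
          · intro f hf g hg hfg
            obtain ⟨-, hx, hy⟩ := mem_filter.1 hf
            obtain ⟨-, hx', hy'⟩ := mem_filter.1 hg
            rw [← sdiff_union_of_subset (show {x, y} ⊆ f by simp [insert_subset_iff, hx, hy]),
              ← sdiff_union_of_subset (show {x, y} ⊆ g by simp [insert_subset_iff, hx', hy'])]
            exact congrArg (· ∪ {x, y}) hfg
      _ = (#(robustNbrs s H (centerSet s H L f₀))).choose (r + 1) := card_powersetCard _ _
      _ ≤ _ := Nat.choose_le_choose _ (hm _ hf₀)
  have hcount : #G * ((r + 3) * (r + 2)) ≤ n ^ 2 * m.choose (r + 1) := by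
    have h1 : ∀ f ∈ G, #f.offDiag = (r + 3) * (r + 2) := by
      intro f hf
      rw [offDiag_card, (mem_powersetCard.1 (mem_filter.1 hf).1).2, ← Nat.mul_sub_one]
      rfl
    calc #G * ((r + 3) * (r + 2)) = ∑ f ∈ G, #f.offDiag := by
          rw [sum_congr rfl h1]
          simp
      _ = ∑ f ∈ G, #((univ : Finset (Fin n)).offDiag.filter fun q ↦ q.1 ∈ f ∧ q.2 ∈ f) := by
          refine sum_congr rfl fun f _ ↦ congrArg card ?_
          ext q
          simp only [mem_offDiag, mem_filter, mem_univ, true_and]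
          tauto
      _ = ∑ q ∈ (univ : Finset (Fin n)).offDiag, #(G.filter fun f ↦ q.1 ∈ f ∧ q.2 ∈ f) :=
          sum_card_bipartiteAbove_eq_sum_card_bipartiteBelow _
      _ ≤ ∑ _q ∈ (univ : Finset (Fin n)).offDiag, m.choose (r + 1) :=
          sum_le_sum fun q hq ↦ hpair q (mem_offDiag.1 hq).2.2
      _ ≤ _ := by
          rw [sum_const, smul_eq_mul, offDiag_card, card_univ, Fintype.card_fin, sq]
          gcongr
          exact Nat.sub_le _ _
  calc #G * (r + 3).factorial = #G * ((r + 3) * (r + 2)) * (r + 1).factorial := by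
        rw [Nat.factorial_succ, Nat.factorial_succ]
        ring
    _ ≤ n ^ 2 * m.choose (r + 1) * (r + 1).factorial := by gcongr
    _ = n ^ 2 * m.descFactorial (r + 1) := by
        rw [Nat.descFactorial_eq_factorial_mul_choose]
        ring
    _ ≤ _ := by
        gcongr
        exact Nat.descFactorial_le_pow _ _

lemma card_missingSets_le {r : ℕ} :
    #(missingSets (r + 1) H S) ≤
      #S * #((powersetCard r univ).filter fun f ↦ ¬ centerSet s H L f = S) := by
  refine (card_le_card (t := (S ×ˢ ((powersetCard r univ).filter
    fun f ↦ ¬ centerSet s H L f = S)).image fun q ↦ insert q.1 q.2) ?_).trans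
    (card_image_le.trans (card_product _ _).le)
  intro e he
  obtain ⟨he, heS, heH⟩ := mem_filter.1 he
  obtain ⟨w, hw, hwS⟩ := not_disjoint_iff.1 heS
  refine mem_image.2 ⟨(w, e.erase w), mem_product.2 ⟨hwS, mem_filter.2
    ⟨mem_powersetCard.2 ⟨subset_univ _, ?_⟩, fun h ↦ heH ?_⟩⟩, insert_erase hw⟩
  · rw [card_erase_of_mem hw, (mem_powersetCard.1 he).2, Nat.add_sub_cancel]
  · have := (mem_filter.1 (h ▸ hwS : w ∈ centerSet s H L (e.erase w))).2.2.1
    rwa [insert_erase hw] at this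

lemma exists_card_missingSets_le {r t l : ℕ} (ht : 1 ≤ t) (htn : t ≤ n)
    (hs : (2 * t + 1) * (r + 5) ≤ s) (hH : ∀ e ∈ H, #e = r + 4)
    (hcard : #H = n.choose (r + 4) - (n - t).choose (r + 4))
    (hfree : CycleFree (r + 4) (2 * t + 1) H) (hL : #L ≤ l) {E : ℕ}
    (hE : (t ^ 2 + l * (l + 2 ^ l * (t + (r + 4)) ^ (r + 3))) * n ^ (r + 2) +
      #(H.filter fun e ↦ ¬ ∃ w ∈ L, IsCenter s H e w) ≤ E) :
    ∃ S : Finset (Fin n), #S = t ∧ #(missingSets (r + 4) H S) ≤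
      t * (E + ((r + 3).factorial * E + (r + 3) ^ 2 * n ^ (r + 2))) := by
  set G := typicalSets s H L (r + 3) t (t + (r + 4)) with hG
  set P : Finset (Finset (Fin n)) := powersetCard (r + 3) univ with hP
  have hPc : #P = n.choose (r + 3) := by simp [hP]
  have hGP : G ⊆ P := filter_subset _ _
  have hPG : #P ≤ #G + E := by
    have h1 := mul_choose_add_choose_sub_le (r + 2) htn
    have h2 := (card_filter_isCenter_mem_le_sum hH).trans
      (sum_card_centerSet_le (L := L) ht (by omega) hs hH hfree)
    have h3 := card_filter_add_card_filter_not (s := H) fun e ↦ ∃ w ∈ L, IsCenter s H e w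
    have h4 : #L * (#L * n ^ (r + 2) + 2 ^ #L * (t + (r + 4)) ^ (r + 3)) ≤
        l * (l + 2 ^ l * (t + (r + 4)) ^ (r + 3)) * n ^ (r + 2) := by
      calc #L * (#L * n ^ (r + 2) + 2 ^ #L * (t + (r + 4)) ^ (r + 3))
          ≤ l * (l * n ^ (r + 2) + 2 ^ l * (t + (r + 4)) ^ (r + 3)) := by
            gcongr
            exact one_le_two
        _ ≤ l * (l * n ^ (r + 2) + 2 ^ l * (t + (r + 4)) ^ (r + 3) * n ^ (r + 2)) :=
            Nat.mul_le_mul_left _ (Nat.add_le_add_left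
              (Nat.le_mul_of_pos_right _ (pow_pos (by omega) _)) _)
        _ = _ := by ring
    have h5 : t * n.choose (r + 3) = (t - 1) * n.choose (r + 3) + n.choose (r + 3) := by
      rw [← Nat.succ_mul]
      congr 1
      omega
    have h6 : (n - t).choose (r + 4) ≤ n.choose (r + 4) :=
      Nat.choose_le_choose _ (Nat.sub_le _ _)
    rw [add_mul] at hE
    rw [hPc]
    simp only [Nat.add_assoc, Nat.reduceAdd] at h1 h2
    rw [← hG] at h2
    omega
  suffices h : ∃ S : Finset (Fin n), #S = t ∧ #(P.filter fun f ↦ ¬ centerSet s H L f = S) ≤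
      E + ((r + 3).factorial * E + (r + 3) ^ 2 * n ^ (r + 2)) by
    obtain ⟨S, hS, hle⟩ := h
    refine ⟨S, hS, (card_missingSets_le (s := s) (L := L)).trans ?_⟩
    rw [hS]
    exact Nat.mul_le_mul_left t hle
  rcases G.eq_empty_or_nonempty with hG0 | hGne
  · obtain ⟨S, -, hS⟩ := exists_subset_card_eq (s := (univ : Finset (Fin n))) (n := t) (by simpa)
    refine ⟨S, hS, (card_filter_le _ _).trans (hPG.trans ?_)⟩
    rw [hG0, card_empty]
    omega
  obtain ⟨f₀, hf₀, hmax⟩ := exists_max_image G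
    (fun f ↦ #(robustNbrs s H (centerSet s H L f))) hGne
  obtain ⟨-, hf₀L, hf₀t, hf₀X⟩ := mem_filter.1 hf₀
  set X := robustNbrs s H (centerSet s H L f₀) with hX
  have hsmall : n ^ (r + 2) * #Xᶜ ≤ (r + 3).factorial * E + (r + 3) ^ 2 * n ^ (r + 2) := by
    have h1 := pow_le_descFactorial_add n (r + 3)
    have h2 := card_typicalSets_mul_factorial_le (L := L) ht hs hH hfree hmax
    have hXn : #X ≤ n := (card_le_univ _).trans (by simp)
    have h3 : n ^ 2 * #X ^ (r + 1) ≤ n ^ (r + 2) * #X := by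
      calc n ^ 2 * #X ^ (r + 1) = n ^ 2 * #X ^ r * #X := by ring
        _ ≤ n ^ 2 * n ^ r * #X := by gcongr
        _ = _ := by ring
    have h4 : n ^ (r + 2) * #Xᶜ + n ^ (r + 2) * #X = n ^ (r + 3) := by
      rw [← mul_add, card_compl_add_card, Fintype.card_fin]
      ring
    rw [Nat.descFactorial_eq_factorial_mul_choose, ← hPc] at h1
    have h5 := Nat.mul_le_mul_left (r + 3).factorial hPG
    rw [mul_add] at h5
    rw [mul_comm] at h2
    rw [← hG] at h2
    simp only [show r + 3 - 1 = r + 2 from rfl] at h1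
    omega
  refine ⟨_, hf₀t, ?_⟩
  have hother : #(G.filter fun f ↦ ¬ centerSet s H L f = centerSet s H L f₀) ≤
      n ^ (r + 2) * #Xᶜ := by
    have h1 := card_le_of_forall_card_inter_le_one (r := r + 2) (X := X)
      (𝒜 := G.filter fun f ↦ ¬ centerSet s H L f = centerSet s H L f₀)
      (fun f hf ↦ (mem_powersetCard.1 (hGP (mem_filter.1 hf).1)).2) (fun f hf ↦ by
        obtain ⟨hf, hne⟩ := mem_filter.1 hf
        obtain ⟨-, hfL, hft, -⟩ := mem_filter.1 hf
        obtain ⟨w, hw, hw₀⟩ := not_subset.1 fun hsub ↦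
          hne (eq_of_subset_of_card_le hsub (by omega))
        exact card_inter_robustNbrs_le_of_mem_centerSet ht (by omega) hs hH hfree hf₀t hf₀X hw hw₀
          (hfL.mono_right (filter_subset _ _)))
    have hXn : #Xᶜ ≤ n := (card_le_univ _).trans (by simp)
    calc _ ≤ n * #Xᶜ ^ (r + 2) := h1
      _ = n * #Xᶜ ^ (r + 1) * #Xᶜ := by ring
      _ ≤ n * n ^ (r + 1) * #Xᶜ := by gcongr
      _ = _ := by ring
  have hsub : (P.filter fun f ↦ ¬ centerSet s H L f = centerSet s H L f₀) ⊆
      (P \ G) ∪ G.filter fun f ↦ ¬ centerSet s H L f = centerSet s H L f₀ := by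
    intro f hf
    obtain ⟨hf, hne⟩ := mem_filter.1 hf
    by_cases hfG : f ∈ G
    · exact mem_union_right _ (mem_filter.2 ⟨hfG, hne⟩)
    · exact mem_union_left _ (mem_sdiff.2 ⟨hf, hfG⟩)
  have hdiff : #(P \ G) ≤ E := by
    rw [card_sdiff_of_subset hGP]
    omega
  have := (card_le_card hsub).trans (card_union_le _ _)
  omega

/-- Stability: an extremal hypergraph contains almost all the `k`-sets meeting some `t`-set. -/
theorem exists_mul_card_missingSets_le {k t : ℕ} (hk : 5 ≤ k) (ht : 1 ≤ t) (N : ℕ) :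
    ∃ n₀ : ℕ, ∀ n ≥ n₀, ∀ H : Finset (Finset (Fin n)), (∀ e ∈ H, #e = k) →
      #H = n.choose k - (n - t).choose k → CycleFree k (2 * t + 1) H →
      ∃ S : Finset (Fin n), #S = t ∧ N * #(missingSets k H S) ≤ n ^ (k - 1) := by
  obtain ⟨r, rfl⟩ : ∃ r, k = r + 4 := ⟨k - 4, by omega⟩
  obtain ⟨K, hK⟩ := exists_card_filter_not_isCenter_mem_le (s := 2 * (r + 4) +
    (2 * t + 1) * (r + 5)) hk ht (by omega) (Nat.le_add_left _ _)
  set a := t * (1 + (r + 3).factorial) with ha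
  set N₀ := 8 * t * a * N with hN₀
  set l := 4 * t * N₀ with hl
  set c := t ^ 2 + l * (l + 2 ^ l * (t + (r + 4)) ^ (r + 3)) with hc
  refine ⟨t + 2 * N * (a * (c + K) + t * (r + 3) ^ 2), fun n hn H hH hcard hfree ↦ ?_⟩
  obtain ⟨L, hL, hlow⟩ := hK H N₀ (by omega) hH hfree
  obtain ⟨S, hS, hmiss⟩ := exists_card_missingSets_le (L := L) ht (by omega)
    (s := 2 * (r + 4) + (2 * t + 1) * (r + 5))
    (Nat.le_add_left _ _) hH hcard hfree hL le_rfl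
  refine ⟨S, hS, ?_⟩
  rw [← hc] at hmiss
  simp only [show r + 4 - 2 = r + 2 from rfl, show r + 4 - 1 = r + 3 from rfl] at hlow ⊢
  set M := #(missingSets (r + 4) H S)
  set lo := #(H.filter fun e ↦ ¬ ∃ w ∈ L, IsCenter _ H e w)
  have hlow' : 2 * a * N * lo ≤ 2 * a * N * (K * n ^ (r + 2)) + n ^ (r + 3) := by
    refine Nat.le_of_mul_le_mul_left (c := 4 * t) ?_ (by omega)
    calc 4 * t * (2 * a * N * lo) = N₀ * lo := by rw [hN₀]; ring
      _ ≤ _ := hlow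
      _ = _ := by rw [hN₀]; ring
  have hbig : 2 * N * (a * (c + K) + t * (r + 3) ^ 2) * n ^ (r + 2) ≤ n ^ (r + 3) := by
    rw [pow_succ' n (r + 2)]
    gcongr
    exact (Nat.le_add_left _ _).trans hn
  have hmiss' : 2 * N * M ≤ 2 * N * (a * (c * n ^ (r + 2) + lo) + t * (r + 3) ^ 2 * n ^ (r + 2)) := by
    refine Nat.mul_le_mul_left _ (hmiss.trans_eq ?_)
    rw [ha]
    ring
  linarith

end Stability

section Exactness

lemma pow_le_mul_choose_sub {n r d : ℕ} (h : 2 * (r + d) ≤ n) :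
    n ^ r ≤ 2 ^ r * r.factorial * (n - d).choose r := by
  calc n ^ r ≤ (2 * (n - d + 1 - r)) ^ r := Nat.pow_le_pow_left (by omega) r
    _ = 2 ^ r * (n - d + 1 - r) ^ r := mul_pow _ _ _
    _ ≤ 2 ^ r * (n - d).descFactorial r := by
      gcongr
      exact Nat.pow_sub_le_descFactorial _ _
    _ = _ := by rw [Nat.descFactorial_eq_factorial_mul_choose, mul_assoc]

variable {n s : ℕ} {H : Finset (Finset (Fin n))} {S : Finset (Fin n)}

lemma choose_le_card_missingSets_mem {r : ℕ} {x w : Fin n} (hxw : x ≠ w) (hw : w ∈ S)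
    (h : ¬ Robust s H {x, w}) :
    (n - (s + 2)).choose r ≤ #((missingSets (r + 2) H S).filter fun e ↦ x ∈ e) := by
  obtain ⟨Z, hZ, hZd, hZH⟩ : ∃ Z : Finset (Fin n), #Z ≤ s ∧ Disjoint {x, w} Z ∧
      ∀ e ∈ H, {x, w} ⊆ e → ¬ Disjoint e Z := by
    unfold Robust at h
    push Not at h
    exact h
  have hxZ : x ∉ Z := disjoint_left.1 hZd (by simp)
  have hwZ : w ∉ Z := disjoint_left.1 hZd (by simp)
  have hc : n - (s + 2) ≤ #({x, w} ∪ Z)ᶜ := by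
    rw [card_compl, Fintype.card_fin]
    have := card_union_le {x, w} Z
    rw [card_pair hxw] at this
    omega
  refine (Nat.choose_le_choose r hc).trans ?_
  rw [← card_powersetCard]
  refine card_le_card_of_injOn (fun g ↦ {x, w} ∪ g) (fun g hg ↦ ?_) fun g hg g' hg' hgg' ↦ ?_
  · obtain ⟨hg, hgc⟩ := mem_powersetCard.1 hg
    have hd : Disjoint ({x, w} ∪ Z) g := (subset_compl_iff_disjoint_left.1 hg)
    rw [disjoint_union_left] at hd
    refine mem_coe.2 (mem_filter.2 ⟨mem_filter.2 ⟨mem_powersetCard.2 ⟨subset_univ _, ?_⟩,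
      not_disjoint_iff.2 ⟨w, by simp, hw⟩, fun he ↦ hZH _ he subset_union_left ?_⟩, by simp⟩)
    · rw [card_union_of_disjoint hd.1, card_pair hxw, hgc, add_comm]
    · exact disjoint_union_left.2 ⟨hZd, hd.2.symm⟩
  · have hd : ∀ g ∈ (powersetCard r ({x, w} ∪ Z)ᶜ : Set (Finset (Fin n))), Disjoint {x, w} g :=
      fun g hg ↦ (disjoint_union_left.1
        (subset_compl_iff_disjoint_left.1 (mem_powersetCard.1 (mem_coe.1 hg)).1)).1
    rw [← union_sdiff_cancel_left (hd g hg), ← union_sdiff_cancel_left (hd g' hg')]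
    exact congrArg (· \ {x, w}) hgg'

lemma card_compl_mul_choose_le (r : ℕ) :
    #(S ∪ robustNbrs s H S)ᶜ * (n - (s + 2)).choose r ≤
      (r + 2) * #(missingSets (r + 2) H S) := by
  have h1 : ∀ x ∈ (S ∪ robustNbrs s H S)ᶜ, (n - (s + 2)).choose r ≤
      #((missingSets (r + 2) H S).filter fun e ↦ x ∈ e) := by
    intro x hx
    rw [mem_compl, mem_union, not_or] at hx
    obtain ⟨w, hw, hwr⟩ : ∃ w ∈ S, ¬ Robust s H {x, w} := by
      by_contra hcon
      push Not at hcon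
      exact hx.2 (mem_filter.2 ⟨mem_univ _, hx.1, hcon⟩)
    exact choose_le_card_missingSets_mem (fun h ↦ hx.1 (h ▸ hw)) hw hwr
  calc _ = ∑ _x ∈ (S ∪ robustNbrs s H S)ᶜ, (n - (s + 2)).choose r := by simp
    _ ≤ ∑ x ∈ (S ∪ robustNbrs s H S)ᶜ, #((missingSets (r + 2) H S).filter fun e ↦ x ∈ e) :=
      sum_le_sum h1
    _ ≤ ∑ x, #((missingSets (r + 2) H S).filter fun e ↦ x ∈ e) :=
      sum_le_univ_sum_of_nonneg fun _ ↦ Nat.zero_le _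
    _ = ∑ e ∈ missingSets (r + 2) H S, #((univ : Finset (Fin n)).filter fun x ↦ x ∈ e) :=
      sum_card_bipartiteAbove_eq_sum_card_bipartiteBelow _
    _ = ∑ e ∈ missingSets (r + 2) H S, (r + 2) := by
      refine sum_congr rfl fun e he ↦ ?_
      rw [filter_mem_eq_inter, univ_inter, (mem_powersetCard.1 (mem_filter.1 he).1).2]
    _ = _ := by rw [sum_const, smul_eq_mul, mul_comm]

lemma card_missingSets_eq {k t : ℕ} (hS : #S = t) (hH : ∀ e ∈ H, #e = k)
    (hcard : #H = n.choose k - (n - t).choose k) :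
    #(missingSets k H S) = #(H.filter fun e ↦ Disjoint e S) := by
  have h1 := card_filter_add_card_filter_not (s := H) fun e ↦ Disjoint e S
  have h2 := card_filter_add_card_filter_not (s := powersetCard k (univ : Finset (Fin n)))
    fun e ↦ Disjoint e S
  have h3 : (powersetCard k (univ : Finset (Fin n))).filter (fun e ↦ Disjoint e S) =
      powersetCard k Sᶜ := by
    ext e
    simp only [mem_filter, mem_powersetCard, subset_univ, true_and,
      subset_compl_iff_disjoint_right]
    tauto
  have h4 := card_filter_add_card_filter_not
    (s := (powersetCard k (univ : Finset (Fin n))).filter fun e ↦ ¬ Disjoint e S) fun e ↦ e ∈ H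
  have h5 : ((powersetCard k (univ : Finset (Fin n))).filter fun e ↦ ¬ Disjoint e S).filter
      (fun e ↦ e ∈ H) = H.filter fun e ↦ ¬ Disjoint e S := by
    ext e
    have := hH e
    simp only [mem_filter, mem_powersetCard, subset_univ, true_and]
    tauto
  rw [h3, card_powersetCard, card_powersetCard, card_compl, card_univ, Fintype.card_fin, hS] at h2
  rw [h5, filter_filter] at h4
  rw [missingSets]
  omega

/-- A hypergraph that is extremal and close to the extremal example is the extremal example. -/
theorem exists_eq_of_mul_card_missingSets_le {k t : ℕ} (hk : 5 ≤ k) (ht : 1 ≤ t) :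
    ∃ N n₀ : ℕ, ∀ n ≥ n₀, ∀ H : Finset (Finset (Fin n)), (∀ e ∈ H, #e = k) →
      #H = n.choose k - (n - t).choose k → CycleFree k (2 * t + 1) H →
      ∀ S : Finset (Fin n), #S = t → N * #(missingSets k H S) ≤ n ^ (k - 1) →
        ∀ e : Finset (Fin n), e ∈ H ↔ #e = k ∧ (e ∩ S).Nonempty := by
  obtain ⟨r, rfl⟩ : ∃ r, k = r + 4 := ⟨k - 4, by omega⟩
  set s := 2 * (r + 4) + (2 * t + 1) * (r + 5) with hs
  obtain ⟨K, hK⟩ : ∃ K : ℕ, ∀ {n : ℕ} (B : Finset (Finset (Fin n))),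
      (∀ e ∈ B, #e = r + 4) → CycleFree (r + 4) (2 * t + 1) B → ∀ S : Finset (Finset (Fin n)),
      (∀ e ∈ B, ∀ f ⊆ e, #f = r + 3 → f ∈ S) → #B ≤ K * #S := by
    obtain ⟨t, rfl⟩ : ∃ u, t = u + 1 := ⟨t - 1, by omega⟩
    exact card_le_mul_card_of_shadow_subset (s := s) (m := 2 * t + 1) (by omega) (by omega)
      (by omega) (Nat.le_add_left _ _)
  set c := 2 ^ (r + 2) * (r + 2).factorial * (r + 4) with hc
  have hc0 : 0 < c := by positivity
  refine ⟨K * c ^ 2 + 2 * c + 1, 2 * (r + 2 + (s + 2)) + 4 * t + 2 * (r + 4),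
    fun n hn H hH hcard hfree S hS hmiss ↦ ?_⟩
  rw [show r + 4 - 1 = r + 3 from rfl] at hmiss
  set N := K * c ^ 2 + 2 * c + 1 with hN
  set B := H.filter fun e ↦ Disjoint e S with hB
  set Y := (S ∪ robustNbrs s H S)ᶜ with hY
  have hMB : #(missingSets (r + 4) H S) = #B := card_missingSets_eq hS hH hcard
  have hYM : #Y * n ^ (r + 2) ≤ c * #B := by
    calc #Y * n ^ (r + 2)
        ≤ #Y * (2 ^ (r + 2) * (r + 2).factorial * (n - (s + 2)).choose (r + 2)) := by
          gcongr
          exact pow_le_mul_choose_sub (by omega)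
      _ = 2 ^ (r + 2) * (r + 2).factorial * (#Y * (n - (s + 2)).choose (r + 2)) := by ring
      _ ≤ 2 ^ (r + 2) * (r + 2).factorial * ((r + 4) * #(missingSets (r + 4) H S)) :=
          Nat.mul_le_mul_left _ (card_compl_mul_choose_le (r + 2))
      _ = _ := by rw [hMB]; ring
  rw [hMB] at hmiss
  have hNY : N * #Y ≤ c * n := by
    refine Nat.le_of_mul_le_mul_right (c := n ^ (r + 2)) ?_ (pow_pos (by omega) _)
    calc N * #Y * n ^ (r + 2) = N * (#Y * n ^ (r + 2)) := by ring
      _ ≤ N * (c * #B) := by gcongr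
      _ = c * (N * #B) := by ring
      _ ≤ c * n ^ (r + 3) := by gcongr
      _ = _ := by ring
  have hY2 : 2 * #Y ≤ n := by
    refine Nat.le_of_mul_le_mul_left (c := c) ?_ hc0
    refine le_trans ?_ hNY
    rw [hN, ← mul_assoc, mul_comm c 2]
    gcongr
    omega
  have hYn : #Y ≤ n := by omega
  have hX : t + (r + 4) ≤ #(robustNbrs s H S) := by
    have h1 := card_union_le S (robustNbrs s H S)
    have h2 := card_add_card_compl (S ∪ robustNbrs s H S)
    rw [Fintype.card_fin, ← hY] at h2
    omega
  have hBcard : #B ≤ K * (n * #Y ^ (r + 2)) := by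
    refine (hK B (fun e he ↦ hH e (mem_filter.1 he).1) (hfree.mono (filter_subset _ _))
      (B.biUnion fun e ↦ powersetCard (r + 3) e) fun e he f hf hfc ↦
        mem_biUnion.2 ⟨e, he, mem_powersetCard.2 ⟨hf, hfc⟩⟩).trans ?_
    gcongr
    refine card_le_of_forall_card_inter_le_one (X := S ∪ robustNbrs s H S) (fun f hf ↦ ?_)
      fun f hf ↦ ?_
    · obtain ⟨e, -, hf⟩ := mem_biUnion.1 hf
      exact (mem_powersetCard.1 hf).2
    · obtain ⟨e, he, hf⟩ := mem_biUnion.1 hf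
      obtain ⟨he, heS⟩ := mem_filter.1 he
      have hfe := (mem_powersetCard.1 hf).1
      rw [inter_union_distrib_left, disjoint_iff_inter_eq_empty.1 (heS.mono_left hfe),
        empty_union]
      exact (card_le_card (inter_subset_inter_right hfe)).trans (card_inter_robustNbrs_le ht
        (by omega) (Nat.le_add_left _ _) hH hfree hS hX he heS)
  have hNB : N * #B ≤ K * c ^ 2 * #B := by
    calc N * #B ≤ N * (K * (n * #Y ^ (r + 2))) := by gcongr
      _ = K * n * (N * #Y) * (#Y ^ r * #Y) := by ring
      _ ≤ K * n * (c * n) * (n ^ r * #Y) := by gcongr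
      _ = K * c * (#Y * n ^ (r + 2)) := by ring
      _ ≤ K * c * (c * #B) := by gcongr
      _ = _ := by ring
  have hB0 : #B = 0 := by
    by_contra hne
    have := Nat.le_of_mul_le_mul_right hNB (Nat.pos_of_ne_zero hne)
    omega
  intro e
  rw [← not_disjoint_iff_nonempty_inter]
  constructor
  · refine fun he ↦ ⟨hH e he, fun hd ↦ ?_⟩
    exact notMem_empty e (card_eq_zero.1 hB0 ▸ mem_filter.2 ⟨he, hd⟩)
  · rintro ⟨hek, heS⟩
    by_contra he
    refine notMem_empty e (card_eq_zero.1 (hMB.trans hB0) ▸ mem_filter.2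
      ⟨mem_powersetCard.2 ⟨subset_univ _, hek⟩, heS, he⟩)

end Exactness

end LinearCycle

/-- Theorem 3, odd case, extremal structure: for `k ≥ 5` and sufficiently large `n`, any extremal `k`-uniform hypergraph with no linear cycle of length `2t+1` consists of all `k`-sets meeting a fixed `t`-set `S`. -/
theorem extremal_linear_cycle_odd (k t : ℕ) (hk : 5 ≤ k) (ht : 1 ≤ t) :
    ∃ n₀ : ℕ, ∀ n ≥ n₀, ∀ H : Finset (Finset (Fin n)),
      (∀ e ∈ H, e.card = k) →
      H.card = Nat.choose n k - Nat.choose (n - t) k →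
      (¬ ∃ A : ZMod (2 * t + 1) → Finset (Fin n),
          IsLinearCycle k (2 * t + 1) A ∧ ∀ i, A i ∈ H) →
      ∃ S : Finset (Fin n), S.card = t ∧
        ∀ e : Finset (Fin n), e ∈ H ↔ e.card = k ∧ (e ∩ S).Nonempty := by
  obtain ⟨N, n₁, h₁⟩ := LinearCycle.exists_eq_of_mul_card_missingSets_le hk ht
  obtain ⟨n₂, h₂⟩ := LinearCycle.exists_mul_card_missingSets_le hk ht N
  refine ⟨max n₁ n₂, fun n hn H hH hcard hfree ↦ ?_⟩
  obtain ⟨S, hS, hmiss⟩ := h₂ n (le_of_max_le_right hn) H hH hcard hfree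
  refine ⟨S, hS, fun e ↦ ?_⟩
  convert h₁ n (le_of_max_le_left hn) H hH hcard hfree S hS hmiss e
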